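/- Let I = (0,a), 0 < a ≤ ∞, let φ be an N-function with complementary function φ*, and w a positive decreasing weight function on I. Let M_{φ,w} be the class of measurable f with ∫_I φ(λf°/w) w < ∞ for some λ > 0 (f° the decreasing rearrangement), with ‖f‖_M = inf{ ε > 0 : ∫_I φ(f°/(ε w)) w ≤ 1 }. Then the Köthe dual (M_{φ,w})' equals, as a set, the Orlicz–Lorentz space Λ_{φ*,w} = { f : ∫_I φ*(λ f°) w < ∞ for some λ > 0 }, and for every f ∈ Λ_{φ*,w} the Orlicz norm satisfies ‖f‖⁰_{Λ_{φ*,w}} = sup { ∫_I f g : g ∈ M_{φ,w}, ‖g‖_M ≤ 1 }. (In particular, if W(t) = ∫₀ᵗ w = ∞ for all t > 0 then (M_{φ,w})' = {0}.) -/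

import Mathlib

open MeasureTheory Set Filter Topology ENNReal

noncomputable section

namespace OrliczRearrangement

/-- An Orlicz function: convex on `[0,∞)`, strictly increasing on `[0,∞)` and vanishing at `0`. -/
def IsOrliczFn (φ : ℝ → ℝ) : Prop :=
  ConvexOn ℝ (Set.Ici 0) φ ∧ StrictMonoOn φ (Set.Ici 0) ∧ φ 0 = 0

/-- An `N`-function: an Orlicz function with `φ(t)/t → 0` as `t → 0⁺` and `φ(t)/t → ∞`
as `t → ∞`. -/
def IsNFn (φ : ℝ → ℝ) : Prop :=
  IsOrliczFn φ ∧ Filter.Tendsto (fun t => φ t / t) (nhdsWithin 0 (Set.Ioi 0)) (nhds 0) ∧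
    Filter.Tendsto (fun t => φ t / t) Filter.atTop Filter.atTop

/-- The complementary (conjugate) function `φ*(t) = sup_{s>0} (st - φ(s))`. -/
def conjFn (φ : ℝ → ℝ) (t : ℝ) : ℝ := sSup ((fun s => s * t - φ s) '' Set.Ioi 0)

/-- The interval `I = (0,a)`, `0 < a ≤ ∞`, as a subset of `ℝ`. -/
def Ioa' (a : ℝ≥0∞) : Set ℝ := {t : ℝ | 0 < t ∧ ENNReal.ofReal t < a}

/-- Distribution function `d_f(s) = |{t ∈ (0,a) : |f(t)| > s}|`. -/
def distr (a : ℝ≥0∞) (f : ℝ → ℝ) (s : ℝ) : ℝ≥0∞ := volume {t ∈ Ioa' a | s < |f t|}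

/-- Decreasing rearrangement `f*(t) = inf{s ≥ 0 : d_f(s) ≤ t}` of `f` on `(0,a)`,
with value `∞` when no such `s` exists. -/
def decRe (a : ℝ≥0∞) (f : ℝ → ℝ) (t : ℝ) : ℝ≥0∞ :=
  sInf (ENNReal.ofReal '' {s : ℝ | 0 ≤ s ∧ distr a f s ≤ ENNReal.ofReal t})

/-- Distribution of a sequence: `d_x(s) = |{k : |x(k)| > s}|`. -/
def sdistr (x : ℕ → ℝ) (s : ℝ) : ℕ∞ := {k : ℕ | s < |x k|}.encard

/-- Decreasing rearrangement of a sequence (`0`-indexed):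
`x*(n) = inf{s > 0 : d_x(s) ≤ n}`, with value `∞` when no such `s` exists. -/
def sdecRe (x : ℕ → ℝ) (n : ℕ) : ℝ≥0∞ :=
  sInf (ENNReal.ofReal '' {s : ℝ | 0 < s ∧ sdistr x s ≤ (n : ℕ∞)})

/-- The extended-real quantity `φ(c/v)·v`, with the convention that for `v = 0` it equals
`0` if `c = 0` and `∞` if `c ≠ 0`. -/
def oterm (φ : ℝ → ℝ) (c v : ℝ) : ℝ≥0∞ :=
  if v = 0 then (if c = 0 then 0 else ∞) else ENNReal.ofReal (φ (c / v) * v)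

/-- The quantity `φ(c/v)·v` for an extended-real numerator `c`; it equals `∞` when
`c = ∞`. -/
def otermE (φ : ℝ → ℝ) (c : ℝ≥0∞) (v : ℝ) : ℝ≥0∞ :=
  if c = ∞ then ∞ else oterm φ c.toReal v

/-- The modular `M(f) = ∫_I φ(f*/w)·w`. -/
def Mmod (a : ℝ≥0∞) (φ w f : ℝ → ℝ) : ℝ≥0∞ :=
  ∫⁻ t in Ioa' a, otermE φ (decRe a f t) (w t)

/-- The functional `‖f‖_M = inf{ε > 0 : M(f/ε) ≤ 1}` (equal to `∞` if no such `ε`). -/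
def Mnorm (a : ℝ≥0∞) (φ w f : ℝ → ℝ) : ℝ≥0∞ :=
  ⨅ ε ∈ {ε : ℝ | 0 < ε ∧ Mmod a φ w (fun t => f t / ε) ≤ 1}, ENNReal.ofReal ε

/-- The class `M_{φ,w}` of measurable `f` with `M(λf) < ∞` for some `λ > 0`. -/
def Mclass (a : ℝ≥0∞) (φ w : ℝ → ℝ) : Set (ℝ → ℝ) :=
  {f | Measurable f ∧ ∃ c > 0, Mmod a φ w (fun t => c * f t) < ∞}

/-- Submajorization `v ≺ w` on `(0,a)`: `∫₀ᵗ v* ≤ ∫₀ᵗ w*` for all `t ∈ (0,a)`. -/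
def Submaj (a : ℝ≥0∞) (v w : ℝ → ℝ) : Prop :=
  ∀ t ∈ Ioa' a, ∫⁻ s in Set.Ioo 0 t, decRe a v s ≤ ∫⁻ s in Set.Ioo 0 t, decRe a w s

/-- The modular `P`, for (decreasing-rearrangement-like) `[0,∞]`-valued data `F`:
`P(F) = inf{∫_I φ(F/v)·v : v ≥ 0, v ≺ w}`. -/
def PmodE (a : ℝ≥0∞) (φ w : ℝ → ℝ) (F : ℝ → ℝ≥0∞) : ℝ≥0∞ :=
  ⨅ v ∈ {v : ℝ → ℝ | Measurable v ∧ (∀ t, 0 ≤ v t) ∧ Submaj a v w},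
    ∫⁻ t in Ioa' a, otermE φ (F t) (v t)

/-- The modular `P(f) = inf{∫_I φ(|f|/v)·v : v ≥ 0, v ≺ w}`. -/
def Pmod (a : ℝ≥0∞) (φ w f : ℝ → ℝ) : ℝ≥0∞ :=
  PmodE a φ w fun t => ENNReal.ofReal |f t|

/-- The norm of `𝓜_{φ,w}` for `[0,∞]`-valued data. -/
def PnormE (a : ℝ≥0∞) (φ w : ℝ → ℝ) (F : ℝ → ℝ≥0∞) : ℝ≥0∞ :=
  ⨅ ε ∈ {ε : ℝ | 0 < ε ∧ PmodE a φ w (fun t => F t / ENNReal.ofReal ε) ≤ 1},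
    ENNReal.ofReal ε

/-- The norm `‖f‖_𝓜 = inf{ε > 0 : P(f/ε) ≤ 1}`. -/
def Pnorm (a : ℝ≥0∞) (φ w f : ℝ → ℝ) : ℝ≥0∞ :=
  PnormE a φ w fun t => ENNReal.ofReal |f t|

/-- The space `𝓜_{φ,w}` of measurable `f` with `P(λf) < ∞` for some `λ > 0`. -/
def Pclass (a : ℝ≥0∞) (φ w : ℝ → ℝ) : Set (ℝ → ℝ) :=
  {f | Measurable f ∧ ∃ c > 0, Pmod a φ w (fun t => c * f t) < ∞}

/-- Sequence submajorization `v ≺ w`. -/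
def sSubmaj (v w : ℕ → ℝ) : Prop :=
  ∀ m : ℕ, ∑ n ∈ Finset.range m, sdecRe v n ≤ ∑ n ∈ Finset.range m, sdecRe w n

/-- Sequence modular `p` for `[0,∞]`-valued data. -/
def spmodE (φ : ℝ → ℝ) (w : ℕ → ℝ) (X : ℕ → ℝ≥0∞) : ℝ≥0∞ :=
  ⨅ v ∈ {v : ℕ → ℝ | (∀ n, 0 ≤ v n) ∧ sSubmaj v w}, ∑' n, otermE φ (X n) (v n)

/-- Sequence modular `p(x) = inf{∑ φ(|x(n)|/v(n))·v(n) : v ≥ 0, v ≺ w}`. -/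
def spmod (φ : ℝ → ℝ) (w x : ℕ → ℝ) : ℝ≥0∞ :=
  spmodE φ w fun n => ENNReal.ofReal |x n|

/-- Sequence norm for `[0,∞]`-valued data. -/
def spnormE (φ : ℝ → ℝ) (w : ℕ → ℝ) (X : ℕ → ℝ≥0∞) : ℝ≥0∞ :=
  ⨅ ε ∈ {ε : ℝ | 0 < ε ∧ spmodE φ w (fun n => X n / ENNReal.ofReal ε) ≤ 1},
    ENNReal.ofReal ε

/-- Sequence norm `‖x‖_𝔪 = inf{ε > 0 : p(x/ε) ≤ 1}`. -/
def spnorm (φ : ℝ → ℝ) (w x : ℕ → ℝ) : ℝ≥0∞ :=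
  spnormE φ w fun n => ENNReal.ofReal |x n|

/-- Dilation operator `D₂f(t) = f(t/2)`, where `f` is extended by `0` outside `(0,a)`. -/
def D2 (a : ℝ≥0∞) (f : ℝ → ℝ) : ℝ → ℝ := fun t => (Ioa' a).indicator f (t / 2)

/-- A measure preserving transformation from `S` onto `S`. -/
def MeasPresOn (σ : ℝ → ℝ) (S : Set ℝ) : Prop :=
  Set.MapsTo σ S S ∧ Set.SurjOn σ S S ∧ Measurable σ ∧
    ∀ A : Set ℝ, A ⊆ S → MeasurableSet A → volume (S ∩ σ ⁻¹' A) = volume A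

/-- Luxemburg norm of the weighted Orlicz space `L_φ(w)` on `(0,a)`. -/
def luxNorm (a : ℝ≥0∞) (φ w g : ℝ → ℝ) : ℝ≥0∞ :=
  ⨅ ε ∈ {ε : ℝ | 0 < ε ∧
      ∫⁻ t in Ioa' a, ENNReal.ofReal (φ (|g t| / ε) * w t) ≤ 1}, ENNReal.ofReal ε

/-- The Orlicz norm of `f` in `Λ_{φ*,w}`, defined by duality with the unit ball of
`L_φ(w)`: `‖f‖⁰ = sup{∫_I f° g w : g ≥ 0, ‖g‖_{L_φ(w)} ≤ 1}`. -/
def lamOnorm (a : ℝ≥0∞) (φ w f : ℝ → ℝ) : ℝ≥0∞ :=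
  ⨆ g ∈ {g : ℝ → ℝ | Measurable g ∧ (∀ t, 0 ≤ g t) ∧ luxNorm a φ w g ≤ 1},
    ∫⁻ t in Ioa' a, decRe a f t * ENNReal.ofReal (g t * w t)

/-- The Orlicz–Lorentz class `Λ_{φs,w}`: measurable `g` whose (finite) decreasing
rearrangement satisfies `∫_I φs(c·g°)·w < ∞` for some `c > 0`. -/
def LamClass (a : ℝ≥0∞) (φs w : ℝ → ℝ) : Set (ℝ → ℝ) :=
  {g | Measurable g ∧ (∀ t ∈ Ioa' a, decRe a g t < ∞) ∧
    ∃ c > 0, ∫⁻ t in Ioa' a, ENNReal.ofReal (φs (c * (decRe a g t).toReal) * w t) < ∞}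

/-- The (generalized right-continuous) inverse `φ⁻¹(y) = inf{s ≥ 0 : φ(s) ≥ y}`. -/
def phiInv (φ : ℝ → ℝ) (y : ℝ) : ℝ := sInf {s : ℝ | 0 ≤ s ∧ y ≤ φ s}

theorem measurableSet_Ioa' (a : ℝ≥0∞) : MeasurableSet (Ioa' a) :=
  measurableSet_Ioi.inter (measurableSet_lt ENNReal.measurable_ofReal measurable_const)

theorem Ioa'_top : Ioa' ∞ = Ioi 0 := by
  ext t; simp [Ioa']

theorem Ioa'_ofReal (b : ℝ) : Ioa' (ENNReal.ofReal b) = Ioo 0 b := by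
  ext t
  simp only [Ioa', mem_ofPred_eq, mem_Ioo]
  refine and_congr_right fun ht => ?_
  rw [ENNReal.ofReal_lt_ofReal_iff']
  exact ⟨fun h => h.1, fun h => ⟨h, ht.trans h⟩⟩

theorem volume_Ioa' (m : ℝ≥0∞) : volume (Ioa' m) = m := by
  induction m with
  | top => rw [Ioa'_top, Real.volume_Ioi]
  | coe x =>
    rw [← ENNReal.ofReal_coe_nnreal, Ioa'_ofReal, Real.volume_Ioo, sub_zero]

theorem Ioa'_inter (m n : ℝ≥0∞) : Ioa' m ∩ Ioa' n = Ioa' (min m n) := by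
  ext t; simp only [Ioa', mem_inter_iff, mem_ofPred_eq, lt_min_iff]; tauto

section Rearrangement

variable {X : Type*} [MeasurableSpace X] {μ : Measure X}

/-- The decreasing rearrangement of a `[0,∞]`-valued function on a measure space. -/
def rearr (μ : Measure X) (F : X → ℝ≥0∞) (τ : ℝ) : ℝ≥0∞ :=
  sInf {y | μ {x | y < F x} ≤ ENNReal.ofReal τ}

theorem rearr_le {F : X → ℝ≥0∞} {τ : ℝ} {y : ℝ≥0∞}
    (h : μ {x | y < F x} ≤ ENNReal.ofReal τ) : rearr μ F τ ≤ y := sInf_le h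

theorem lt_rearr_iff {F : X → ℝ≥0∞} {τ : ℝ} {y : ℝ≥0∞} :
    y < rearr μ F τ ↔ ENNReal.ofReal τ < μ {x | y < F x} := by
  refine ⟨fun h => not_le.1 fun h' => h.not_ge (rearr_le h'), fun h => ?_⟩
  have hy : y < ∞ := by
    by_contra hy
    simp [top_le_iff.1 (not_lt.1 hy)] at h
  obtain ⟨v, hv, hvm, hvt⟩ := exists_seq_strictAnti_tendsto' hy
  have hU : {x | y < F x} = ⋃ n, {x | v n < F x} := by
    ext x
    simp only [mem_ofPred_eq, mem_iUnion]
    exact ⟨fun hx => (hvt.eventually_lt_const hx).exists, fun ⟨n, hn⟩ => (hvm n).1.trans hn⟩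
  have hmono : Monotone fun n => {x | v n < F x} := fun i j hij x hx =>
    (hv.antitone hij).trans_lt hx
  rw [hU, hmono.measure_iUnion, lt_iSup_iff] at h
  obtain ⟨n, hn⟩ := h
  refine (hvm n).1.trans_le (le_sInf fun z hz => ?_)
  by_contra! hzn
  exact ((measure_mono fun x hx => hzn.trans hx).trans hz).not_gt hn

theorem rearr_antitone (μ : Measure X) (F : X → ℝ≥0∞) : Antitone (rearr μ F) := fun _ _ hst =>
  sInf_le_sInf fun _ hy => le_trans hy (ENNReal.ofReal_le_ofReal hst)

theorem measurable_rearr (μ : Measure X) (F : X → ℝ≥0∞) : Measurable (rearr μ F) :=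
  (rearr_antitone μ F).measurable

theorem rearr_eq_zero {F : X → ℝ≥0∞} {τ : ℝ} (h : μ univ ≤ ENNReal.ofReal τ) :
    rearr μ F τ = 0 :=
  nonpos_iff_eq_zero.1 (rearr_le ((measure_mono (subset_univ _)).trans h))

theorem setOf_lt_rearr (F : X → ℝ≥0∞) (y : ℝ≥0∞) :
    {τ | y < rearr μ F τ} ∩ Ioi 0 = Ioa' (μ {x | y < F x}) := by
  ext τ
  simp only [mem_inter_iff, mem_ofPred_eq, mem_Ioi, lt_rearr_iff, Ioa', and_comm]

/-- The layer cake formula for `[0,∞]`-valued functions. -/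
theorem lintegral_eq_lintegral_distribution [SFinite μ] {P : X → ℝ≥0∞} (hP : Measurable P) :
    ∫⁻ x, P x ∂μ = ∫⁻ s in Ioi (0 : ℝ), μ {x | ENNReal.ofReal s < P x} := by
  have hset : MeasurableSet {p : X × ℝ | ENNReal.ofReal p.2 < P p.1} :=
    measurableSet_lt (ENNReal.measurable_ofReal.comp measurable_snd) (hP.comp measurable_fst)
  have h1 : ∀ x, P x = ∫⁻ s in Ioi (0 : ℝ),
      {p : X × ℝ | ENNReal.ofReal p.2 < P p.1}.indicator 1 (x, s) := by
    intro x
    have : (fun s => {p : X × ℝ | ENNReal.ofReal p.2 < P p.1}.indicator (1 : X × ℝ → ℝ≥0∞) (x, s))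
        = {s : ℝ | ENNReal.ofReal s < P x}.indicator 1 := rfl
    rw [this, lintegral_indicator_one (measurableSet_lt ENNReal.measurable_ofReal measurable_const),
      Measure.restrict_apply
        (measurableSet_lt ENNReal.measurable_ofReal measurable_const), inter_comm]
    exact (volume_Ioa' (P x)).symm
  rw [lintegral_congr h1, lintegral_lintegral_swap]
  · refine lintegral_congr fun s => ?_
    exact lintegral_indicator_one (s := {x | ENNReal.ofReal s < P x})
      (measurableSet_lt measurable_const hP)
  · exact (measurable_one.indicator hset).aemeasurable

theorem lintegral_rearr [SFinite μ] {P : X → ℝ≥0∞} (hP : Measurable P) :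
    ∫⁻ τ in Ioi (0 : ℝ), rearr μ P τ = ∫⁻ x, P x ∂μ := by
  rw [lintegral_eq_lintegral_distribution hP,
    lintegral_eq_lintegral_distribution (measurable_rearr μ P)]
  refine lintegral_congr fun s => ?_
  rw [Measure.restrict_apply (measurableSet_lt measurable_const (measurable_rearr μ P)),
    setOf_lt_rearr, volume_Ioa']

theorem lintegral_mul_eq_lintegral_distribution [SFinite μ] {P Q : X → ℝ≥0∞}
    (hP : Measurable P) (hQ : Measurable Q) :
    ∫⁻ x, P x * Q x ∂μ = ∫⁻ s in Ioi (0 : ℝ), ∫⁻ r in Ioi (0 : ℝ),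
      μ ({x | ENNReal.ofReal r < Q x} ∩ {x | ENNReal.ofReal s < P x}) := by
  have h := lintegral_withDensity_eq_lintegral_mul μ hQ hP
  simp only [Pi.mul_apply] at h
  simp_rw [mul_comm (P _)]
  rw [← h, lintegral_eq_lintegral_distribution hP]
  refine lintegral_congr fun s => ?_
  rw [withDensity_apply _ (measurableSet_lt measurable_const hP),
    lintegral_eq_lintegral_distribution hQ]
  refine lintegral_congr fun r => ?_
  rw [Measure.restrict_apply (measurableSet_lt measurable_const hQ)]

/-- The Hardy–Littlewood inequality. -/
theorem lintegral_mul_le_lintegral_rearr [SFinite μ] {P Q : X → ℝ≥0∞}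
    (hP : Measurable P) (hQ : Measurable Q) :
    ∫⁻ x, P x * Q x ∂μ ≤ ∫⁻ τ in Ioa' (μ univ), rearr μ P τ * rearr μ Q τ := by
  have h0 : ∫⁻ τ in Ioa' (μ univ), rearr μ P τ * rearr μ Q τ =
      ∫⁻ τ in Ioi (0 : ℝ), rearr μ P τ * rearr μ Q τ := by
    rw [← lintegral_indicator (measurableSet_Ioa' _), ← lintegral_indicator measurableSet_Ioi]
    refine lintegral_congr fun τ => ?_
    by_cases h : τ ∈ Ioa' (μ univ)
    · rw [indicator_of_mem h, indicator_of_mem (show τ ∈ Ioi 0 from h.1)]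
    · rw [indicator_of_notMem h]
      by_cases hτ : τ ∈ Ioi (0 : ℝ)
      · rw [indicator_of_mem hτ, rearr_eq_zero (not_lt.1 fun h' => h ⟨hτ, h'⟩), zero_mul]
      · rw [indicator_of_notMem hτ]
  rw [h0, lintegral_mul_eq_lintegral_distribution hP hQ,
    lintegral_mul_eq_lintegral_distribution (measurable_rearr μ P) (measurable_rearr μ Q)]
  refine lintegral_mono fun s => lintegral_mono fun r => ?_
  rw [Measure.restrict_apply ((measurableSet_lt measurable_const (measurable_rearr μ Q)).inter
      (measurableSet_lt measurable_const (measurable_rearr μ P))),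
    inter_inter_distrib_right, setOf_lt_rearr, setOf_lt_rearr, Ioa'_inter, volume_Ioa']
  exact le_min (measure_mono inter_subset_left) (measure_mono inter_subset_right)

end Rearrangement

theorem volume_restrict_Ioa'_Iic (m : ℝ≥0∞) (r : ℝ) :
    volume.restrict (Ioa' m) (Iic r) = min (ENNReal.ofReal r) m := by
  have h : (Iio r : Set ℝ) =ᵐ[volume.restrict (Ioa' m)] Iic r := Iio_ae_eq_Iic
  rw [← measure_congr h, Measure.restrict_apply measurableSet_Iio]
  have : Iio r ∩ Ioa' m = Ioa' (min (ENNReal.ofReal r) m) := by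
    rw [← Ioa'_inter, Ioa'_ofReal]
    ext t
    simp only [Ioa', mem_inter_iff, mem_Iio, mem_Ioo, mem_ofPred_eq]
    tauto
  rw [this, volume_Ioa']

theorem ext_of_Iic_of_lt_top (μ ν : Measure ℝ) (hμ : ∀ r, μ (Iic r) ≠ ∞)
    (h : ∀ r, μ (Iic r) = ν (Iic r)) : μ = ν := by
  refine Measure.ext_of_Ioc' μ ν (fun a b _ => ?_) fun a b hab => ?_
  · exact ne_top_of_le_ne_top (hμ b) (measure_mono Ioc_subset_Iic_self)
  · have hs : Iic a ⊆ Iic b := Iic_subset_Iic.2 hab.le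
    rw [← Iic_sdiff_Iic, measure_sdiff hs measurableSet_Iic.nullMeasurableSet (hμ a),
      measure_sdiff hs measurableSet_Iic.nullMeasurableSet (h a ▸ hμ a), h, h]

/-- The distribution transform of a function with null level sets pushes the measure forward
to Lebesgue measure on an interval. -/
theorem map_distribution_transform {X : Type*} [MeasurableSpace X] {μ : Measure X} {u : X → ℝ}
    {l : ℝ} (hu : Measurable u) (hl : ∀ᵐ x ∂μ, l < u x) (hfin : ∀ s, l < s → μ {x | s < u x} ≠ ∞)
    (hnull : ∀ c, μ {x | u x = c} = 0) :
    Measurable (fun x => (μ {y | u x < u y}).toReal) ∧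
    Measure.map (fun x => (μ {y | u x < u y}).toReal) μ = volume.restrict (Ioa' (μ univ)) := by
  have hanti : Antitone fun s => μ {y | s < u y} := fun s t hst =>
    measure_mono fun y hy => lt_of_le_of_lt hst hy
  have hmeas : Measurable (fun x => (μ {y | u x < u y}).toReal) :=
    ENNReal.measurable_toReal.comp (hanti.measurable.comp hu)
  refine ⟨hmeas, ?_⟩
  have hpos : ∀ r, 0 < r → μ {x | (μ {y | u x < u y}).toReal ≤ r} =
      min (ENNReal.ofReal r) (μ univ) := by
    intro r hr
    rcases le_or_gt (μ univ) (ENNReal.ofReal r) with h | h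
    · rw [min_eq_right h]
      congr 1
      refine eq_univ_of_forall fun x => ENNReal.toReal_le_of_le_ofReal hr.le ?_
      exact (measure_mono (subset_univ _)).trans h
    rw [min_eq_left h.le]
    set S : Set ℝ := {s | l < s ∧ μ {y | s < u y} ≤ ENNReal.ofReal r} with hS
    have hne : S.Nonempty := by
      have hI : (⋂ n : ℕ, {y | (l + 1 + n : ℝ) < u y}) = ∅ := by
        refine eq_empty_of_forall_notMem fun y hy => ?_
        obtain ⟨n, hn⟩ := exists_nat_gt (u y - l - 1)
        have := mem_iInter.1 hy n
        simp only [mem_ofPred_eq] at this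
        linarith
      have ht := tendsto_measure_iInter_atTop (μ := μ)
        (s := fun n : ℕ => {y | (l + 1 + n : ℝ) < u y})
        (fun n => (measurableSet_lt measurable_const hu).nullMeasurableSet)
        (fun i j hij y hy => by
          have hy' : l + 1 + (j : ℝ) < u y := hy
          have : (i : ℝ) ≤ j := by exact_mod_cast hij
          change l + 1 + (i : ℝ) < u y
          linarith)
        ⟨0, hfin _ (by simp)⟩
      rw [hI, measure_empty] at ht
      obtain ⟨n, hn⟩ := (ht.eventually_lt_const (ENNReal.ofReal_pos.2 hr)).exists
      exact ⟨l + 1 + n, by have := n.cast_nonneg (α := ℝ); linarith, hn.le⟩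
    have hbdd : BddBelow S := ⟨l, fun s hs => hs.1.le⟩
    set s₀ := sInf S
    have hls : l ≤ s₀ := le_csInf hne fun s hs => hs.1.le
    have hd : μ {y | s₀ < u y} ≤ ENNReal.ofReal r := by
      obtain ⟨v, hv, hvm, hvt⟩ := exists_seq_strictAnti_tendsto s₀
      have hU : {y | s₀ < u y} = ⋃ n, {y | v n < u y} := by
        ext y
        simp only [mem_ofPred_eq, mem_iUnion]
        exact ⟨fun hy => (hvt.eventually_lt_const hy).exists, fun ⟨n, hn⟩ => (hvm n).trans hn⟩
      have hmono : Monotone fun n => {y | v n < u y} := fun i j hij y hy =>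
        (hv.antitone hij).trans_lt hy
      rw [hU, hmono.measure_iUnion]
      refine iSup_le fun n => ?_
      obtain ⟨s, hs, hsv⟩ := exists_lt_of_csInf_lt hne (hvm n)
      exact (hanti hsv.le).trans hs.2
    have hls' : l < s₀ := by
      refine lt_of_le_of_ne hls fun he => ?_
      have : μ {y | s₀ < u y} = μ univ := by
        rw [← he]
        exact measure_congr (eventuallyEq_univ.2 hl)
      exact (this ▸ hd).not_gt h
    have hge : ENNReal.ofReal r ≤ μ {y | s₀ ≤ u y} := by
      obtain ⟨v, hv, hvm, hvt⟩ := exists_seq_strictMono_tendsto' hls'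
      have hU : {y | s₀ ≤ u y} = ⋂ n, {y | v n < u y} := by
        ext y
        simp only [mem_ofPred_eq, mem_iInter]
        exact ⟨fun hy n => (hvm n).2.trans_le hy, fun h => le_of_tendsto' hvt fun n => (h n).le⟩
      have hmono : Antitone fun n => {y | v n < u y} := fun i j hij y hy =>
        (hv.monotone hij).trans_lt hy
      rw [hU, hmono.measure_iInter
        (fun n => (measurableSet_lt measurable_const hu).nullMeasurableSet)
        ⟨0, hfin _ (hvm 0).1⟩]
      refine le_iInf fun n => le_of_lt ?_
      by_contra! hcon
      exact (csInf_le hbdd ⟨(hvm n).1, hcon⟩).not_gt (hvm n).2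
    have heq : μ {y | s₀ ≤ u y} ≤ μ {y | s₀ < u y} := by
      calc μ {y | s₀ ≤ u y} ≤ μ ({y | s₀ < u y} ∪ {y | u y = s₀}) :=
            measure_mono fun y (hy : s₀ ≤ u y) => (lt_or_eq_of_le hy).imp id Eq.symm
        _ ≤ _ := measure_union_le _ _
        _ = _ := by rw [hnull, add_zero]
    have hae : {x | (μ {y | u x < u y}).toReal ≤ r} =ᵐ[μ] {y | s₀ ≤ u y} := by
      filter_upwards [hl] with x hx
      have : (μ {y | u x < u y}).toReal ≤ r ↔ s₀ ≤ u x := by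
        rw [← ENNReal.le_ofReal_iff_toReal_le (hfin _ hx) hr.le]
        refine ⟨fun h' => csInf_le hbdd ⟨hx, h'⟩, fun h' => (hanti h').trans hd⟩
      exact propext this
    rw [measure_congr hae]
    exact le_antisymm (heq.trans hd) hge
  have hall : ∀ r, Measure.map (fun x => (μ {y | u x < u y}).toReal) μ (Iic r) =
      min (ENNReal.ofReal r) (μ univ) := by
    intro r
    rw [Measure.map_apply hmeas measurableSet_Iic]
    rcases lt_or_ge 0 r with hr | hr
    · exact hpos r hr
    · rw [ENNReal.ofReal_of_nonpos hr, zero_min, ← nonpos_iff_eq_zero]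
      refine le_of_forall_gt fun b hb => ?_
      obtain ⟨ε, hε, hεb⟩ := ENNReal.lt_iff_exists_real_btwn.1 hb
      have hε0 : 0 < ε := ENNReal.ofReal_pos.1 hεb.1
      refine lt_of_le_of_lt (measure_mono fun x hx => ?_)
        (((hpos ε hε0).le.trans (min_le_left _ _)).trans_lt hεb.2)
      exact le_trans hx (hr.trans hε)
  refine ext_of_Iic_of_lt_top _ _ (fun r => ?_) fun r => ?_
  · rw [hall]
    exact ne_top_of_le_ne_top ENNReal.ofReal_ne_top (min_le_left _ _)
  · rw [hall, volume_restrict_Ioa'_Iic]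

/-- A subset of `(0,∞)` of infinite measure has subsets of every finite measure. -/
theorem exists_subset_volume_eq {E : Set ℝ} (hE : MeasurableSet E) (hE0 : E ⊆ Ioi 0)
    (hinf : volume E = ∞) (r : ℝ) :
    ∃ B ⊆ E, MeasurableSet B ∧ volume B = ENNReal.ofReal r := by
  obtain ⟨hm, hmap⟩ := map_distribution_transform (μ := volume.restrict E) (u := fun x : ℝ => x⁻¹)
    (l := 0) measurable_inv
    ((ae_restrict_mem hE).mono fun x hx => inv_pos.2 (hE0 hx))
    (fun s hs => by
      rw [Measure.restrict_apply (measurableSet_lt measurable_const measurable_inv)]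
      refine ne_top_of_le_ne_top (b := volume (Ioo 0 s⁻¹)) (by simp) (measure_mono fun x hx => ?_)
      exact ⟨hE0 hx.2, (lt_inv_comm₀ hs (hE0 hx.2)).1 hx.1⟩)
    (fun c => by
      refine measure_mono_null (t := {c⁻¹}) (fun x hx => ?_) (by simp)
      simp only [mem_ofPred_eq] at hx
      simp [← hx])
  set σ := fun x : ℝ => (volume.restrict E {y : ℝ | x⁻¹ < y⁻¹}).toReal
  refine ⟨E ∩ σ ⁻¹' (Iic r), inter_subset_left, hE.inter (hm measurableSet_Iic), ?_⟩
  rw [inter_comm, ← Measure.restrict_apply (hm measurableSet_Iic),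
    ← Measure.map_apply hm measurableSet_Iic, hmap, volume_restrict_Ioa'_Iic,
    Measure.restrict_apply_univ, hinf, min_eq_left le_top]

theorem distr_eq {a : ℝ≥0∞} {f : ℝ → ℝ} (hf : Measurable f) {s : ℝ} (hs : 0 ≤ s) :
    distr a f s = volume.restrict (Ioa' a) {x | ENNReal.ofReal s < ENNReal.ofReal |f x|} := by
  have hm : MeasurableSet {x | ENNReal.ofReal s < ENNReal.ofReal |f x|} :=
    measurableSet_lt measurable_const (ENNReal.measurable_ofReal.comp (measurable_abs.comp hf))
  rw [Measure.restrict_apply hm, distr, inter_comm]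
  simp_rw [ENNReal.ofReal_lt_ofReal_iff_of_nonneg hs]
  rfl

theorem decRe_eq_rearr {a : ℝ≥0∞} {f : ℝ → ℝ} (hf : Measurable f) :
    decRe a f = rearr (volume.restrict (Ioa' a)) fun x => ENNReal.ofReal |f x| := by
  ext t
  refine le_antisymm (le_sInf fun y hy => ?_) (le_sInf ?_)
  · rcases eq_or_ne y ∞ with rfl | hy'
    · exact le_top
    refine sInf_le ⟨y.toReal, ⟨ENNReal.toReal_nonneg, ?_⟩, ENNReal.ofReal_toReal hy'⟩
    rw [distr_eq hf ENNReal.toReal_nonneg, ENNReal.ofReal_toReal hy']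
    exact hy
  · rintro _ ⟨s, ⟨hs, hd⟩, rfl⟩
    refine rearr_le ?_
    rwa [← distr_eq hf hs]

theorem decRe_antitone (a : ℝ≥0∞) (f : ℝ → ℝ) : Antitone (decRe a f) := fun _ _ hst =>
  sInf_le_sInf (image_mono fun _ hs => ⟨hs.1, hs.2.trans (ENNReal.ofReal_le_ofReal hst)⟩)

theorem measurable_decRe (a : ℝ≥0∞) (f : ℝ → ℝ) : Measurable (decRe a f) :=
  (decRe_antitone a f).measurable

theorem decRe_le_of_distr_le {a : ℝ≥0∞} {f : ℝ → ℝ} {s t : ℝ} (hs : 0 ≤ s)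
    (h : distr a f s ≤ ENNReal.ofReal t) : decRe a f t ≤ ENNReal.ofReal s :=
  sInf_le ⟨s, ⟨hs, h⟩, rfl⟩

/-- The largest number of the form `b * exp (δ * k)`, with `k` an integer, that is strictly
smaller than `y`. -/
def geomFloor (δ b y : ℝ) : ℝ := b * Real.exp (δ * (⌈Real.log (y / b) / δ⌉ - 1))

section geomFloor

variable {δ b y : ℝ}

theorem measurable_geomFloor (δ b : ℝ) : Measurable (geomFloor δ b) := by
  unfold geomFloor
  refine measurable_const.mul (Real.measurable_exp.comp (measurable_const.mul ?_))
  refine Measurable.sub_const ?_ _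
  refine (measurable_from_top (f := fun n : ℤ => (n : ℝ))).comp (Int.measurable_ceil.comp ?_)
  exact (Real.measurable_log.comp (measurable_id.div_const b)).div_const δ

theorem eq_mul_exp_log_div (hδ : 0 < δ) (hb : 0 < b) (hy : 0 < y) :
    y = b * Real.exp (δ * (Real.log (y / b) / δ)) := by
  rw [mul_div_cancel₀ _ hδ.ne', Real.exp_log (div_pos hy hb), mul_div_cancel₀ _ hb.ne']

theorem geomFloor_pos (hb : 0 < b) : 0 < geomFloor δ b y := mul_pos hb (Real.exp_pos _)

theorem geomFloor_lt (hδ : 0 < δ) (hb : 0 < b) (hy : 0 < y) : geomFloor δ b y < y := by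
  conv_rhs => rw [eq_mul_exp_log_div hδ hb hy]
  unfold geomFloor
  have := Int.ceil_lt_add_one (Real.log (y / b) / δ)
  gcongr
  linarith

theorem le_exp_mul_geomFloor (hδ : 0 < δ) (hb : 0 < b) (hy : 0 < y) :
    y ≤ Real.exp δ * geomFloor δ b y := by
  conv_lhs => rw [eq_mul_exp_log_div hδ hb hy]
  have : Real.exp δ * geomFloor δ b y = b * Real.exp (δ * ⌈Real.log (y / b) / δ⌉) := by
    unfold geomFloor
    rw [mul_left_comm, ← Real.exp_add]
    ring_nf
  rw [this]
  have := Int.le_ceil (Real.log (y / b) / δ)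
  gcongr

theorem le_geomFloor (hδ : 0 < δ) (hb : 0 < b) (hy : b < y) : b ≤ geomFloor δ b y := by
  have h1 : 0 < Real.log (y / b) / δ := div_pos (Real.log_pos ((one_lt_div hb).2 hy)) hδ
  have h2 : (1 : ℝ) ≤ ⌈Real.log (y / b) / δ⌉ := by exact_mod_cast Int.ceil_pos.2 h1
  refine le_mul_of_one_le_right hb.le (Real.one_le_exp (mul_nonneg hδ.le (by linarith)))

theorem geomFloor_le (hδ : 0 < δ) (hb : 0 < b) (hy0 : 0 < y) (hy : y ≤ b * Real.exp δ) :
    geomFloor δ b y ≤ b := by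
  have h1 : Real.log (y / b) / δ ≤ (1 : ℤ) := by
    rw [Int.cast_one, div_le_one hδ, Real.log_le_iff_le_exp (div_pos hy0 hb),
      div_le_iff₀ hb, mul_comm]
    exact hy
  have h2 : (⌈Real.log (y / b) / δ⌉ : ℝ) ≤ 1 := by exact_mod_cast Int.ceil_le.2 h1
  refine mul_le_of_le_one_right hb.le (Real.exp_le_one_iff.2 ?_)
  exact mul_nonpos_of_nonneg_of_nonpos hδ.le (by linarith)

end geomFloor

/-- Every measurable function with a finite value of its distribution function is, up to a constant
factor close to `1`, bounded below by the composition of its decreasing rearrangement with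
a measure preserving map. -/
theorem exists_measure_preserving_decRe_le {a : ℝ≥0∞} {g : ℝ → ℝ} (hg : Measurable g)
    (hfin : ∃ s, 0 ≤ s ∧ distr a g s < ∞) {K : ℝ} (hK : 1 < K) :
    ∃ (A : Set ℝ) (σ : ℝ → ℝ), MeasurableSet A ∧ A ⊆ Ioa' a ∧ Measurable σ ∧
      Measure.map σ (volume.restrict A) = volume.restrict (Ioa' (volume A)) ∧
      (∀ᵐ x ∂volume.restrict A, decRe a g (σ x) ≤ ENNReal.ofReal (K * |g x|)) ∧
      ∀ t, volume A ≤ ENNReal.ofReal t → decRe a g t = 0 := by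
  set δ := Real.log K / 2 with hδdef
  have hδ : 0 < δ := half_pos (Real.log_pos hK)
  have hKδ : K = Real.exp δ * Real.exp δ := by
    rw [← Real.exp_add, hδdef, add_halves, Real.exp_log (by linarith)]
  set κ := (Real.exp δ)⁻¹ with hκdef
  have he1 : 1 < Real.exp δ := Real.one_lt_exp_iff.2 hδ
  have he0 : 0 < Real.exp δ := Real.exp_pos δ
  have hκ0 : 0 < κ := inv_pos.2 he0
  have hκ1 : κ < 1 := inv_lt_one_of_one_lt₀ he1
  have hκe : κ * Real.exp δ = 1 := inv_mul_cancel₀ he0.ne'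
  set p : ℝ → ℝ := fun x => κ + (1 - κ) / (1 + x) with hp
  have hpm : Measurable p :=
    measurable_const.add (measurable_const.div (measurable_const.add measurable_id))
  have hpκ : ∀ x, 0 < x → κ < p x := fun x hx => by
    have : 0 < (1 - κ) / (1 + x) := div_pos (by linarith) (by linarith)
    simp only [hp]; linarith
  have hp1 : ∀ x, 0 < x → p x ≤ 1 := fun x hx => by
    have : (1 - κ) / (1 + x) ≤ 1 - κ := div_le_self (by linarith) (by linarith)
    simp only [hp]; linarith
  have hpinj : ∀ x y, 0 < x → 0 < y → p x = p y → x = y := fun x y hx hy hxy => by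
    simp only [hp] at hxy
    have hxy := add_left_cancel hxy
    rw [div_eq_div_iff (by linarith) (by linarith)] at hxy
    have := mul_left_cancel₀ (by linarith : (1 - κ) ≠ 0) hxy
    linarith
  have hgm : Measurable fun x => |g x| := measurable_abs.comp hg
  obtain ⟨b, m, l, hb, hm, hl, hml, hlow, hup, hend⟩ : ∃ b m l : ℝ, 0 < b ∧ 0 ≤ m ∧ 0 ≤ l ∧
      m ≤ K * l ∧ (∀ x ∈ Ioa' a, m < |g x| → l < geomFloor δ b |g x| * p x) ∧
      (∀ s, l < s → volume {x | s < geomFloor δ b |g x| * p x ∧ x ∈ Ioa' a ∧ m < |g x|} ≠ ∞) ∧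
      ∀ t, volume {x | x ∈ Ioa' a ∧ m < |g x|} ≤ ENNReal.ofReal t → decRe a g t = 0 := by
    set S := {s | 0 ≤ s ∧ distr a g s < ∞} with hS
    have hbdd : BddBelow S := ⟨0, fun s hs => hs.1⟩
    have hanti : ∀ s t, s ≤ t → distr a g t ≤ distr a g s := fun s t hst =>
      measure_mono fun x hx => ⟨hx.1, hst.trans_lt hx.2⟩
    have hgt : ∀ s, sInf S < s → distr a g s < ∞ := fun s hs => by
      obtain ⟨t, ht, hts⟩ := exists_lt_of_csInf_lt hfin hs
      exact (hanti _ _ hts.le).trans_lt ht.2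
    rcases (Real.sInf_nonneg fun s hs => hs.1 : 0 ≤ sInf S).eq_or_lt with h0 | h0
    · refine ⟨1, 0, 0, one_pos, le_rfl, le_rfl, by simp, fun x hx hxg => ?_, fun s hs => ?_,
        fun t ht => ?_⟩
      · exact mul_pos (geomFloor_pos one_pos) (hκ0.trans (hpκ x hx.1))
      · refine ((measure_mono ?_).trans_lt (hgt s (h0 ▸ hs))).ne
        rintro x ⟨hx, hxI, hx0⟩
        refine ⟨hxI, hx.trans ?_⟩
        exact (mul_le_of_le_one_right (geomFloor_pos one_pos).le (hp1 x hxI.1)).trans_lt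
          (geomFloor_lt hδ one_pos hx0)
      · simpa using decRe_le_of_distr_le (le_refl (0 : ℝ)) ht
    · set b := sInf S * Real.exp (-(δ / 2)) with hbdef
      have hb : 0 < b := mul_pos h0 (Real.exp_pos _)
      have hbL : b < sInf S :=
        mul_lt_of_lt_one_right h0 (Real.exp_lt_one_iff.2 (by linarith))
      have hLb : sInf S < b * Real.exp δ := by
        rw [hbdef, mul_assoc, ← Real.exp_add]
        exact lt_mul_of_one_lt_right h0 (Real.one_lt_exp_iff.2 (by linarith))
      refine ⟨b, b, b * κ, hb, hb.le, by positivity, ?_, fun x hx hxg => ?_, fun s hs => ?_,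
        fun t ht => ?_⟩
      · rw [hKδ]
        have : Real.exp δ * Real.exp δ * (b * κ) = b * Real.exp δ := by
          linear_combination b * Real.exp δ * hκe
        rw [this]
        exact le_mul_of_one_le_right hb.le he1.le
      · exact mul_lt_mul' (le_geomFloor hδ hb hxg) (hpκ x hx.1) hκ0.le (geomFloor_pos hb)
      · have hsub : {x | s < geomFloor δ b |g x| * p x ∧ x ∈ Ioa' a ∧ b < |g x|} ⊆
            {x ∈ Ioa' a | b * Real.exp δ < |g x|} ∪ Ioo 0 (b * (1 - κ) / (s - b * κ)) := by
          rintro x ⟨hx, hxI, hxb⟩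
          rcases lt_or_ge (b * Real.exp δ) |g x| with h | h
          · exact Or.inl ⟨hxI, h⟩
          · refine Or.inr ⟨hxI.1, ?_⟩
            have hx0 : 0 < x := hxI.1
            have h1 : s < b * p x := hx.trans_le (mul_le_mul_of_nonneg_right
              (geomFloor_le hδ hb (hb.trans hxb) h) (hκ0.trans (hpκ x hx0)).le)
            have h2 : s - b * κ < b * (1 - κ) / (1 + x) := by
              simp only [hp] at h1
              rw [mul_add, ← mul_div_assoc] at h1
              linarith
            rw [lt_div_iff₀ (by linarith)] at h2
            rw [lt_div_iff₀ (by linarith)]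
            nlinarith
        refine ((measure_mono hsub).trans_lt ((measure_union_le _ _).trans_lt ?_)).ne
        exact ENNReal.add_lt_top.2 ⟨hgt _ hLb, by simp⟩
      · have : distr a g b = ∞ := by
          by_contra h
          exact (csInf_le hbdd ⟨hb.le, lt_top_iff_ne_top.2 h⟩).not_gt hbL
        rw [show {x | x ∈ Ioa' a ∧ b < |g x|} = {t ∈ Ioa' a | b < |g t|} from rfl] at ht
        rw [distr] at this
        simp [this] at ht
  set A : Set ℝ := {x | x ∈ Ioa' a ∧ m < |g x|} with hA
  have hAm : MeasurableSet A :=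
    (measurableSet_Ioa' a).inter (measurableSet_lt measurable_const hgm)
  set u : ℝ → ℝ := fun x => geomFloor δ b |g x| * p x with hu
  have hum : Measurable u := ((measurable_geomFloor δ b).comp hgm).mul hpm
  have hfinu : ∀ s, l < s → volume.restrict A {x | s < u x} ≠ ∞ := fun s hs => by
    rw [Measure.restrict_apply (measurableSet_lt measurable_const hum)]
    exact hup s hs
  obtain ⟨hσm, hσ⟩ := map_distribution_transform (μ := volume.restrict A) hum
    ((ae_restrict_mem hAm).mono fun x hx => hlow x hx.1 hx.2) hfinu
    (fun c => by
      rw [Measure.restrict_apply (measurableSet_eq_fun hum measurable_const)]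
      refine Set.Countable.measure_zero ?_ _
      refine MapsTo.countable_of_injOn (f := fun x => ⌈Real.log (|g x| / b) / δ⌉) (t := univ)
        (mapsTo_univ _ _) (fun x hx y hy hxy => ?_) (to_countable _)
      have hxy' : geomFloor δ b |g x| = geomFloor δ b |g y| := by
        simp only at hxy
        simp only [geomFloor, hxy]
      refine hpinj x y hx.2.1.1 hy.2.1.1 ?_
      have h3 : u x = u y := hx.1.trans hy.1.symm
      simp only [hu, hxy'] at h3
      exact mul_left_cancel₀ (geomFloor_pos hb).ne' h3)
  refine ⟨A, _, hAm, fun x hx => hx.1, hσm, by rwa [Measure.restrict_apply_univ] at hσ, ?_, hend⟩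
  filter_upwards [ae_restrict_mem hAm] with x hx
  have hgx : 0 < |g x| := hm.trans_lt hx.2
  have hux : l < u x := hlow x hx.1 hx.2
  have hux0 : 0 ≤ u x := hl.trans hux.le
  have hK0 : 0 < K := by linarith
  have h1 : decRe a g (volume.restrict A {y | u x < u y}).toReal ≤ ENNReal.ofReal (K * u x) := by
    refine decRe_le_of_distr_le (by positivity) ?_
    rw [ENNReal.ofReal_toReal (hfinu _ hux),
      Measure.restrict_apply (measurableSet_lt measurable_const hum)]
    refine measure_mono fun y hy => ?_
    have hmy : m < |g y| := (hml.trans (mul_le_mul_of_nonneg_left hux.le hK0.le)).trans_lt hy.2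
    refine ⟨?_, hy.1, hmy⟩
    have h2 : |g y| ≤ K * u y := by
      have h3 := le_exp_mul_geomFloor hδ hb (hm.trans_lt hmy)
      have h4 : 1 ≤ Real.exp δ * p y := by
        rw [← hκe, mul_comm]
        exact mul_le_mul_of_nonneg_left (hpκ y hy.1.1).le he0.le
      calc |g y| ≤ Real.exp δ * geomFloor δ b |g y| := h3
        _ ≤ Real.exp δ * geomFloor δ b |g y| * (Real.exp δ * p y) :=
          le_mul_of_one_le_right (mul_nonneg he0.le (geomFloor_pos hb).le) h4
        _ = K * u y := by rw [hKδ]; simp only [hu]; ring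
    exact lt_of_mul_lt_mul_left (hy.2.trans_le h2) hK0.le
  refine h1.trans (ENNReal.ofReal_le_ofReal (mul_le_mul_of_nonneg_left ?_ hK0.le))
  exact (mul_le_of_le_one_right (geomFloor_pos hb).le (hp1 x hx.1.1)).trans
    (geomFloor_lt hδ hb hgx).le

/-- A decreasing function on `(0,a)` dominates the rearrangement of a function whose pairing with
`g` is nearly maximal. -/
theorem exists_decRe_le_lintegral_le {a : ℝ≥0∞} {g : ℝ → ℝ} (hg : Measurable g)
    (hfin : ∃ s, 0 ≤ s ∧ distr a g s < ∞) {K : ℝ} (hK : 1 < K) {G : ℝ → ℝ≥0∞}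
    (hG : Measurable G) (hanti : AntitoneOn G (Ioa' a)) (hGfin : ∀ t ∈ Ioa' a, G t ≠ ∞) :
    ∃ f : ℝ → ℝ, Measurable f ∧ (∀ x, 0 ≤ f x * g x) ∧ (∀ t ∈ Ioa' a, decRe a f t ≤ G t) ∧
      ∫⁻ t in Ioa' a, decRe a g t * G t ≤
        ENNReal.ofReal K * ∫⁻ t in Ioa' a, ENNReal.ofReal (f t * g t) := by
  obtain ⟨A, σ, hA, hAI, hσ, hmap, hle, hend⟩ := exists_measure_preserving_decRe_le hg hfin hK
  have hAa : volume A ≤ a := (measure_mono hAI).trans (volume_Ioa' a).le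
  have hsub : Ioa' (volume A) ⊆ Ioa' a := fun t ht => ⟨ht.1, ht.2.trans_le hAa⟩
  have hσI : ∀ᵐ x ∂volume.restrict A, σ x ∈ Ioa' (volume A) := by
    have := ae_restrict_mem (μ := volume) (measurableSet_Ioa' (volume A))
    rw [← hmap] at this
    exact ae_of_ae_map hσ.aemeasurable this
  set f : ℝ → ℝ := A.indicator fun x => (if 0 ≤ g x then 1 else -1) * (G (σ x)).toReal with hf
  have hfm : Measurable f := by
    refine Measurable.indicator (Measurable.mul ?_ (ENNReal.measurable_toReal.comp (hG.comp hσ))) hA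
    exact Measurable.ite (measurableSet_le measurable_const hg) measurable_const measurable_const
  have hfg : ∀ x, f x * g x = A.indicator (fun x => (G (σ x)).toReal * |g x|) x := by
    intro x
    by_cases hx : x ∈ A
    · rw [hf, indicator_of_mem hx, indicator_of_mem hx]
      split_ifs with h
      · rw [abs_of_nonneg h]; ring
      · rw [abs_of_neg (not_le.1 h)]; ring
    · rw [hf, indicator_of_notMem hx, indicator_of_notMem hx, zero_mul]
  refine ⟨f, hfm, fun x => ?_, fun t ht => ?_, ?_⟩
  · rw [hfg]
    exact indicator_nonneg (fun x _ => mul_nonneg ENNReal.toReal_nonneg (abs_nonneg _)) x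
  · rw [decRe_eq_rearr hfm]
    refine rearr_le ?_
    have hms : MeasurableSet (Iic t ∪ (Ioa' (volume A))ᶜ) :=
      measurableSet_Iic.union (measurableSet_Ioa' _).compl
    have h1 : volume.restrict (Ioa' a) {x | G t < ENNReal.ofReal |f x|} ≤
        volume.restrict A (σ ⁻¹' (Iic t ∪ (Ioa' (volume A))ᶜ)) := by
      have hm : MeasurableSet {x | G t < ENNReal.ofReal |f x|} :=
        measurableSet_lt measurable_const
          (ENNReal.measurable_ofReal.comp (measurable_abs.comp hfm))
      rw [Measure.restrict_apply hm, Measure.restrict_apply (hσ hms)]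
      refine measure_mono fun x hx => ?_
      have hxA : x ∈ A := by
        by_contra h
        have := hx.1
        simp [hf, indicator_of_notMem h] at this
      refine ⟨?_, hxA⟩
      by_contra! hcon
      simp only [mem_preimage, mem_union, mem_Iic, mem_compl_iff, not_or, not_le, not_not] at hcon
      refine (hx.1 : G t < _).not_ge (le_trans ?_ (hanti ht (hsub hcon.2) hcon.1.le))
      have : |f x| = (G (σ x)).toReal := by
        rw [hf, indicator_of_mem hxA, abs_mul, abs_of_nonneg ENNReal.toReal_nonneg]
        split_ifs <;> simp
      rw [this]
      exact ENNReal.ofReal_toReal_le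
    refine h1.trans ?_
    rw [← Measure.map_apply hσ hms, hmap]
    refine (measure_union_le _ _).trans ?_
    rw [volume_restrict_Ioa'_Iic, Measure.restrict_apply (measurableSet_Ioa' _).compl,
      compl_inter_self, measure_empty, add_zero]
    exact min_le_left _ _
  · have hDm : Measurable fun t => decRe a g t * G t := (measurable_decRe a g).mul hG
    calc ∫⁻ t in Ioa' a, decRe a g t * G t
        ≤ ∫⁻ t in Ioa' (volume A), decRe a g t * G t := by
          rw [← lintegral_indicator (measurableSet_Ioa' _),
            ← lintegral_indicator (measurableSet_Ioa' _)]
          refine lintegral_mono fun t => ?_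
          by_cases h : t ∈ Ioa' a
          · rw [indicator_of_mem h]
            by_cases h' : t ∈ Ioa' (volume A)
            · rw [indicator_of_mem h']
            · rw [hend t (not_lt.1 fun h'' => h' ⟨h.1, h''⟩), zero_mul]
              exact zero_le
          · rw [indicator_of_notMem h]
            exact zero_le
      _ = ∫⁻ x in A, decRe a g (σ x) * G (σ x) := by
          rw [← hmap, lintegral_map hDm hσ]
      _ ≤ ∫⁻ x in A, ENNReal.ofReal K * ENNReal.ofReal (f x * g x) := by
          refine lintegral_mono_ae ?_
          filter_upwards [hle, hσI, ae_restrict_mem hA] with x hx hxI hxA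
          rw [hfg, indicator_of_mem hxA, ENNReal.ofReal_mul ENNReal.toReal_nonneg,
            ENNReal.ofReal_toReal (hGfin _ (hsub hxI))]
          refine (mul_le_mul_left hx _).trans ?_
          rw [ENNReal.ofReal_mul (by linarith), mul_assoc, mul_comm (G _)]
      _ ≤ ∫⁻ x in Ioa' a, ENNReal.ofReal K * ENNReal.ofReal (f x * g x) := lintegral_mono_set hAI
      _ = _ := lintegral_const_mul _ (ENNReal.measurable_ofReal.comp (hfm.mul hg))

/-- The extension of `φ` to `[0,∞]` with value `∞` at `∞`. -/
def extFn (φ : ℝ → ℝ) (c : ℝ≥0∞) : ℝ≥0∞ := if c = ∞ then ∞ else ENNReal.ofReal (φ c.toReal)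

section NFunction

variable {φ : ℝ → ℝ}

theorem extFn_top : extFn φ ∞ = ∞ := if_pos rfl

theorem extFn_of_ne_top {c : ℝ≥0∞} (hc : c ≠ ∞) : extFn φ c = ENNReal.ofReal (φ c.toReal) :=
  if_neg hc

theorem extFn_ofReal {s : ℝ} (hs : 0 ≤ s) :
    extFn φ (ENNReal.ofReal s) = ENNReal.ofReal (φ s) := by
  rw [extFn_of_ne_top ofReal_ne_top, ENNReal.toReal_ofReal hs]

theorem otermE_eq (c : ℝ≥0∞) {v : ℝ} (hv : 0 < v) :
    otermE φ c v = extFn φ (c / ENNReal.ofReal v) * ENNReal.ofReal v := by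
  have hv' : ENNReal.ofReal v ≠ 0 := by simpa using hv
  rcases eq_or_ne c ∞ with rfl | hc
  · rw [ENNReal.top_div_of_ne_top ofReal_ne_top, extFn_top, ENNReal.top_mul hv', otermE, if_pos rfl]
  · rw [extFn_of_ne_top (ENNReal.div_ne_top hc hv'), otermE, if_neg hc, oterm, if_neg hv.ne',
      ENNReal.ofReal_mul' hv.le, ENNReal.toReal_div, ENNReal.toReal_ofReal hv.le]

namespace IsNFn

variable (hφ : IsNFn φ)
include hφ

theorem pos {t : ℝ} (ht : 0 < t) : 0 < φ t := by
  rw [← hφ.1.2.2]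
  exact hφ.1.2.1 self_mem_Ici ht.le ht

theorem extFn_zero : extFn φ 0 = 0 := by simp [extFn, hφ.1.2.2]

theorem extFn_mono : Monotone (extFn φ) := fun x y hxy => by
  rcases eq_or_ne y ∞ with rfl | hy
  · simp [extFn_top]
  · have hx := ne_top_of_le_ne_top hy hxy
    rw [extFn_of_ne_top hx, extFn_of_ne_top hy]
    exact ENNReal.ofReal_le_ofReal (hφ.1.2.1.monotoneOn ENNReal.toReal_nonneg
      ENNReal.toReal_nonneg (ENNReal.toReal_mono hy hxy))

theorem measurable_extFn : Measurable (extFn φ) := hφ.extFn_mono.measurable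

theorem mul_le {θ x : ℝ} (hθ : 0 ≤ θ) (hθ1 : θ ≤ 1) (hx : 0 ≤ x) : φ (θ * x) ≤ θ * φ x := by
  have := hφ.1.1.2 (x := x) hx (y := 0) self_mem_Ici hθ (sub_nonneg.2 hθ1) (by ring)
  simpa [hφ.1.2.2] using this

theorem extFn_mul_le {θ : ℝ≥0∞} (hθ : θ ≤ 1) (x : ℝ≥0∞) :
    extFn φ (θ * x) ≤ θ * extFn φ x := by
  have hθ' := ne_top_of_le_ne_top one_ne_top hθ
  rcases eq_or_ne θ 0 with rfl | hθ0
  · simp [hφ.extFn_zero]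
  rcases eq_or_ne x ∞ with rfl | hx
  · rw [extFn_top, ENNReal.mul_top hθ0]
    exact le_top
  rw [extFn_of_ne_top hx, extFn_of_ne_top (ENNReal.mul_ne_top hθ' hx), ENNReal.toReal_mul]
  conv_rhs => rw [← ENNReal.ofReal_toReal hθ', ← ENNReal.ofReal_mul ENNReal.toReal_nonneg]
  exact ENNReal.ofReal_le_ofReal (hφ.mul_le ENNReal.toReal_nonneg
    (ENNReal.toReal_le_of_le_ofReal zero_le_one (by simpa using hθ)) ENNReal.toReal_nonneg)

theorem continuousOn : ContinuousOn φ (Ioi 0) := by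
  have := hφ.1.1.continuousOn_interior
  rwa [interior_Ici] at this

theorem exists_forall_mul_lt (x : ℝ) : ∃ s₀ > 0, ∀ s, s₀ ≤ s → s * x < φ s := by
  obtain ⟨s₀, hs₀⟩ := (hφ.2.2.eventually_gt_atTop x).exists_forall_of_atTop
  refine ⟨max s₀ 1, by positivity, fun s hs => ?_⟩
  have hs0 : 0 < s := one_pos.trans_le ((le_max_right _ _).trans hs)
  have := hs₀ s ((le_max_left _ _).trans hs)
  rwa [lt_div_iff₀ hs0, mul_comm] at this

theorem exists_lt_of_lt_extFn {x y : ℝ≥0∞} (h : y < extFn φ x) : ∃ z < x, y < extFn φ z := by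
  rcases eq_or_ne x ∞ with rfl | hx
  · rw [extFn_top] at h
    obtain ⟨s₀, hs₀, hs⟩ := hφ.exists_forall_mul_lt 1
    refine ⟨ENNReal.ofReal (max s₀ y.toReal), ofReal_lt_top, ?_⟩
    rw [extFn_ofReal (by positivity), ENNReal.lt_ofReal_iff_toReal_lt h.ne]
    have := hs _ (le_max_left s₀ y.toReal)
    rw [mul_one] at this
    exact (le_max_right _ _).trans_lt this
  · have hyt := h.ne_top
    rw [extFn_of_ne_top hx, ENNReal.lt_ofReal_iff_toReal_lt hyt] at h
    have hx0 : 0 < x.toReal := by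
      by_contra hcon
      rw [le_antisymm (not_lt.1 hcon) ENNReal.toReal_nonneg, hφ.1.2.2] at h
      exact h.not_ge ENNReal.toReal_nonneg
    have hc : ContinuousAt φ x.toReal := (hφ.continuousOn).continuousAt (Ioi_mem_nhds hx0)
    have h1 : ∀ᶠ z in 𝓝[<] x.toReal, y.toReal < φ z ∧ 0 < z ∧ z < x.toReal :=
      ((hc.eventually (lt_mem_nhds h)).filter_mono nhdsWithin_le_nhds).and
        (((lt_mem_nhds hx0).filter_mono nhdsWithin_le_nhds).and self_mem_nhdsWithin)
    obtain ⟨z, hz1, hz2, hz3⟩ := h1.exists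
    refine ⟨ENNReal.ofReal z, (ENNReal.ofReal_lt_iff_lt_toReal hz2.le hx).2 hz3, ?_⟩
    rwa [extFn_ofReal hz2.le, ENNReal.lt_ofReal_iff_toReal_lt hyt]

theorem extFn_iSup_le {ι : Type*} (x : ι → ℝ≥0∞) : extFn φ (⨆ i, x i) ≤ ⨆ i, extFn φ (x i) := by
  refine le_of_forall_lt fun y hy => ?_
  obtain ⟨z, hz, hyz⟩ := hφ.exists_lt_of_lt_extFn hy
  obtain ⟨i, hi⟩ := lt_iSup_iff.1 hz
  exact (hyz.trans_le (hφ.extFn_mono hi.le)).trans_le (le_iSup (fun i => extFn φ (x i)) i)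

theorem bddAbove_conj (t : ℝ) : BddAbove ((fun s => s * t - φ s) '' Ioi 0) := by
  obtain ⟨s₀, hs₀, hs⟩ := hφ.exists_forall_mul_lt t
  refine ⟨s₀ * |t|, ?_⟩
  rintro _ ⟨s, hs0, rfl⟩
  have hs0 : 0 < s := hs0
  rcases lt_or_ge s s₀ with h | h
  · have h1 : s * t ≤ s * |t| := mul_le_mul_of_nonneg_left (le_abs_self t) hs0.le
    have h2 : s * |t| ≤ s₀ * |t| := mul_le_mul_of_nonneg_right h.le (abs_nonneg t)
    have := hφ.pos hs0
    simp only; linarith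
  · have := hs s h
    have h2 : 0 ≤ s₀ * |t| := by positivity
    simp only; linarith

theorem sub_le_conjFn {s : ℝ} (hs : 0 < s) (t : ℝ) : s * t - φ s ≤ conjFn φ t :=
  le_csSup (hφ.bddAbove_conj t) ⟨s, hs, rfl⟩

/-- The Young inequality. -/
theorem mul_le_extFn_add_conjFn (x : ℝ≥0∞) (t : ℝ) :
    x * ENNReal.ofReal t ≤ extFn φ x + ENNReal.ofReal (conjFn φ t) := by
  rcases eq_or_ne x ∞ with rfl | hx
  · rw [extFn_top, top_add]
    exact le_top
  rcases eq_or_ne x 0 with rfl | hx0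
  · simp
  have hx' := ENNReal.toReal_pos hx0 hx
  rw [extFn_of_ne_top hx]
  calc x * ENNReal.ofReal t = ENNReal.ofReal (x.toReal * t) := by
        rw [ENNReal.ofReal_mul hx'.le, ENNReal.ofReal_toReal hx]
    _ ≤ ENNReal.ofReal (φ x.toReal + conjFn φ t) := by
        have := hφ.sub_le_conjFn hx' t
        exact ENNReal.ofReal_le_ofReal (by linarith)
    _ ≤ _ := ENNReal.ofReal_add_le

theorem exists_pos_le_conjFn {x₀ : ℝ} (hx₀ : 0 < x₀) :
    ∃ κ > 0, ∀ x, x₀ ≤ x → κ ≤ conjFn φ x := by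
  obtain ⟨s, hs, hs0⟩ := ((hφ.2.1.eventually (gt_mem_nhds hx₀)).and self_mem_nhdsWithin).exists
  have hs0 : 0 < s := hs0
  rw [div_lt_iff₀ hs0] at hs
  refine ⟨s * x₀ - φ s, by linarith, fun x hx => ?_⟩
  have := hφ.sub_le_conjFn hs0 x
  have := mul_le_mul_of_nonneg_left hx hs0.le
  linarith

end IsNFn

/-- The largest `s` with `φ(s) ≤ s x`. -/
def maxSlope (φ : ℝ → ℝ) (x : ℝ≥0∞) : ℝ≥0∞ := sSup {s | s ≠ ∞ ∧ extFn φ s ≤ s * x}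

theorem maxSlope_mono (φ : ℝ → ℝ) : Monotone (maxSlope φ) := fun _ _ hxy =>
  sSup_le_sSup fun s hs => ⟨hs.1, hs.2.trans (mul_le_mul_right hxy s)⟩

namespace IsNFn

variable (hφ : IsNFn φ)
include hφ

theorem extFn_maxSlope_le (x : ℝ≥0∞) : extFn φ (maxSlope φ x) ≤ maxSlope φ x * x := by
  refine le_of_forall_lt fun y hy => ?_
  obtain ⟨z, hz, hyz⟩ := hφ.exists_lt_of_lt_extFn hy
  obtain ⟨s, hs, hzs⟩ := lt_sSup_iff.1 hz
  exact hyz.trans_le ((hφ.extFn_mono hzs.le).trans (hs.2.trans (mul_le_mul_left (le_sSup hs) x)))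

theorem maxSlope_ne_top {x : ℝ≥0∞} (hx : x ≠ ∞) : maxSlope φ x ≠ ∞ := by
  obtain ⟨s₀, hs₀, hs⟩ := hφ.exists_forall_mul_lt x.toReal
  refine ne_top_of_le_ne_top (ofReal_ne_top (r := s₀)) (sSup_le fun s h => ?_)
  by_contra! hcon
  have hs' := hs s.toReal ((ENNReal.ofReal_lt_iff_lt_toReal hs₀.le h.1).1 hcon).le
  have h2 := h.2
  rw [extFn_of_ne_top h.1, ← ENNReal.ofReal_toReal (ENNReal.mul_ne_top h.1 hx),
    ENNReal.ofReal_le_ofReal_iff ENNReal.toReal_nonneg, ENNReal.toReal_mul] at h2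
  exact hs'.not_ge h2

theorem conjFn_le_maxSlope {x : ℝ≥0∞} (hx : x ≠ ∞) :
    ENNReal.ofReal (conjFn φ x.toReal) ≤ maxSlope φ x * x := by
  refine ENNReal.ofReal_le_of_le_toReal (csSup_le ⟨_, 1, mem_Ioi.2 one_pos, rfl⟩ ?_)
  rintro _ ⟨s, hs, rfl⟩
  have hs : 0 < s := hs
  rcases le_or_gt (φ s) (s * x.toReal) with h | h
  · have h1 : ENNReal.ofReal s ≤ maxSlope φ x := by
      refine le_sSup ⟨ofReal_ne_top, ?_⟩
      rw [extFn_ofReal hs.le]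
      refine (ENNReal.ofReal_le_ofReal h).trans ?_
      rw [ENNReal.ofReal_mul hs.le, ENNReal.ofReal_toReal hx]
    have h2 := (ENNReal.ofReal_le_iff_le_toReal (hφ.maxSlope_ne_top hx)).1 h1
    rw [ENNReal.toReal_mul]
    have := mul_le_mul_of_nonneg_right h2 (ENNReal.toReal_nonneg (a := x))
    have := hφ.pos hs
    simp only; linarith
  · have : 0 ≤ (maxSlope φ x * x).toReal := ENNReal.toReal_nonneg
    simp only; linarith

end IsNFn

end NFunction

/-- A positive decreasing weight on `(0,a)`. -/
structure IsWeight (a : ℝ≥0∞) (w : ℝ → ℝ) : Prop where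
  measurable : Measurable w
  pos : ∀ t ∈ Ioa' a, 0 < w t
  anti : ∀ s ∈ Ioa' a, ∀ t ∈ Ioa' a, s ≤ t → w t ≤ w s

/-- The measure on `(0,a)` with density `w`. -/
def wMeas (a : ℝ≥0∞) (w : ℝ → ℝ) : Measure ℝ :=
  (volume.restrict (Ioa' a)).withDensity fun t => ENNReal.ofReal (w t)

section Weight

variable {a : ℝ≥0∞} {w : ℝ → ℝ}

theorem rearr_extFn_le {X : Type*} [MeasurableSpace X] {μ : Measure X} {φ : ℝ → ℝ}
    (hφ : IsNFn φ) (h : X → ℝ≥0∞) (τ : ℝ) :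
    extFn φ (rearr μ h τ) ≤ rearr μ (fun x => extFn φ (h x)) τ := by
  refine le_of_forall_lt fun y hy => ?_
  obtain ⟨z, hz, hyz⟩ := hφ.exists_lt_of_lt_extFn hy
  rw [lt_rearr_iff] at hz ⊢
  exact hz.trans_le (measure_mono fun x hx => hyz.trans_le (hφ.extFn_mono (le_of_lt hx)))

theorem ae_mem_wMeas : ∀ᵐ t ∂wMeas a w, t ∈ Ioa' a :=
  (withDensity_absolutelyContinuous _ _).ae_le (ae_restrict_mem (measurableSet_Ioa' a))

namespace IsWeight

variable (hw : IsWeight a w)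
include hw

theorem measurable_ofReal : Measurable fun t => ENNReal.ofReal (w t) :=
  ENNReal.measurable_ofReal.comp hw.measurable

theorem lintegral_wMeas {h : ℝ → ℝ≥0∞} (hh : Measurable h) :
    ∫⁻ t, h t ∂wMeas a w = ∫⁻ t in Ioa' a, h t * ENNReal.ofReal (w t) := by
  rw [wMeas, lintegral_withDensity_eq_lintegral_mul _ hw.measurable_ofReal hh]
  simp only [Pi.mul_apply, mul_comm]

theorem lintegral_Ioo_le {t₀ b : ℝ} (ht₀ : t₀ ∈ Ioa' a) :
    ∫⁻ s in Ioa' a ∩ Iio b, ENNReal.ofReal (w s) ≤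
      (∫⁻ s in Ioo 0 t₀, ENNReal.ofReal (w s)) + ENNReal.ofReal (w t₀) * ENNReal.ofReal b := by
  have hsub : Ioa' a ∩ Iio b ⊆ Ioo 0 t₀ ∪ (Ico t₀ b ∩ Ioa' a) := fun s hs => by
    rcases lt_or_ge s t₀ with h | h
    · exact Or.inl ⟨hs.1.1, h⟩
    · exact Or.inr ⟨⟨h, hs.2⟩, hs.1⟩
  refine (lintegral_mono_set hsub).trans ((lintegral_union_le _ _ _).trans ?_)
  refine add_le_add_right ?_ _
  calc ∫⁻ s in Ico t₀ b ∩ Ioa' a, ENNReal.ofReal (w s)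
      ≤ ∫⁻ _ in Ico t₀ b ∩ Ioa' a, ENNReal.ofReal (w t₀) :=
        setLIntegral_mono measurable_const fun s hs =>
          ENNReal.ofReal_le_ofReal (hw.anti _ ht₀ _ hs.2 hs.1.1)
    _ = ENNReal.ofReal (w t₀) * volume (Ico t₀ b ∩ Ioa' a) := setLIntegral_const _ _
    _ ≤ _ := by
      gcongr
      refine (measure_mono inter_subset_left).trans ?_
      rw [Real.volume_Ico]
      exact ENNReal.ofReal_le_ofReal (by linarith [ht₀.1])

/-- Rearranging a function with respect to the weighted measure does not increase its modular, and
does not decrease its pairing with a decreasing function. -/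
theorem exists_antitoneOn {φ : ℝ → ℝ} (hφ : IsNFn φ) {t₀ : ℝ} (ht₀ : t₀ ∈ Ioa' a)
    (hfin : ∫⁻ s in Ioo 0 t₀, ENNReal.ofReal (w s) ≠ ∞) {D : ℝ → ℝ≥0∞} (hD : Antitone D)
    {h : ℝ → ℝ≥0∞} (hh : Measurable h) :
    ∃ H : ℝ → ℝ≥0∞, Measurable H ∧ AntitoneOn H (Ioa' a) ∧
      ∫⁻ t in Ioa' a, extFn φ (H t) * ENNReal.ofReal (w t) ≤
        ∫⁻ t in Ioa' a, extFn φ (h t) * ENNReal.ofReal (w t) ∧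
      ∫⁻ t in Ioa' a, D t * (h t * ENNReal.ofReal (w t)) ≤
        ∫⁻ t in Ioa' a, D t * (H t * ENNReal.ofReal (w t)) := by
  set ν := wMeas a w with hν
  have hsf : SFinite ν := by rw [hν, wMeas]; infer_instance
  have hfinν : ∀ s : ℝ, 0 < s → ν {x | s < x⁻¹} ≠ ∞ := fun s hs => by
    rw [hν, wMeas, withDensity_apply _ (measurableSet_lt measurable_const measurable_inv),
      Measure.restrict_restrict (measurableSet_lt measurable_const measurable_inv)]
    refine ne_top_of_le_ne_top (b := (∫⁻ s in Ioo 0 t₀, ENNReal.ofReal (w s)) +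
      ENNReal.ofReal (w t₀) * ENNReal.ofReal s⁻¹) ?_
      ((lintegral_mono_set fun x hx => ?_).trans (hw.lintegral_Ioo_le ht₀))
    · exact ENNReal.add_ne_top.2 ⟨hfin, ENNReal.mul_ne_top ofReal_ne_top ofReal_ne_top⟩
    · exact ⟨hx.2, (lt_inv_comm₀ hs hx.2.1).1 hx.1⟩
  obtain ⟨hσm, hσ⟩ := map_distribution_transform (μ := ν) (u := fun x : ℝ => x⁻¹) (l := 0)
    measurable_inv (ae_mem_wMeas.mono fun x hx => inv_pos.2 hx.1) hfinν
    (fun c => by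
      have h1 : volume.restrict (Ioa' a) {x : ℝ | x⁻¹ = c} = 0 := by
        refine measure_mono_null (t := {c⁻¹}) (fun x hx => ?_) (measure_singleton _)
        rw [mem_singleton_iff, ← (hx : x⁻¹ = c), inv_inv]
      exact withDensity_absolutelyContinuous _ _ h1)
  set σ : ℝ → ℝ := fun x => (ν {y | x⁻¹ < y⁻¹}).toReal with hσdef
  have hσ_mono : ∀ s ∈ Ioa' a, ∀ t ∈ Ioa' a, s ≤ t → σ s ≤ σ t := fun s hs t ht hst => by
    refine ENNReal.toReal_mono (hfinν _ (inv_pos.2 ht.1)) (measure_mono fun y hy => ?_)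
    exact (inv_anti₀ hs.1 hst).trans_lt hy
  have hHm : Measurable fun t => rearr ν h (σ t) := (measurable_rearr ν h).comp hσm
  have hΦm : Measurable fun x => extFn φ (h x) := hφ.measurable_extFn.comp hh
  refine ⟨fun t => rearr ν h (σ t), hHm, fun s hs t ht hst =>
    rearr_antitone ν h (hσ_mono s hs t ht hst), ?_, ?_⟩
  · have hΦHm : Measurable fun t => extFn φ (rearr ν h (σ t)) := hφ.measurable_extFn.comp hHm
    rw [← hw.lintegral_wMeas hΦm, ← hw.lintegral_wMeas hΦHm, ← hν]
    calc ∫⁻ t, extFn φ (rearr ν h (σ t)) ∂ν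
        = ∫⁻ τ in Ioa' (ν univ), extFn φ (rearr ν h τ) := by
          rw [← hσ]
          exact (lintegral_map (hφ.measurable_extFn.comp (measurable_rearr ν h)) hσm).symm
      _ ≤ ∫⁻ τ in Ioi (0 : ℝ), extFn φ (rearr ν h τ) := lintegral_mono_set fun t ht => ht.1
      _ ≤ ∫⁻ τ in Ioi (0 : ℝ), rearr ν (fun x => extFn φ (h x)) τ :=
          lintegral_mono fun τ => rearr_extFn_le hφ h τ
      _ = _ := lintegral_rearr hΦm
  · have hDh : Measurable fun t => D t * h t := hD.measurable.mul hh
    have hDH : Measurable fun t => D t * rearr ν h (σ t) := hD.measurable.mul hHm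
    simp only [← mul_assoc]
    rw [← hw.lintegral_wMeas hDh, ← hw.lintegral_wMeas hDH, ← hν]
    calc ∫⁻ t, D t * h t ∂ν
        ≤ ∫⁻ τ in Ioa' (ν univ), rearr ν D τ * rearr ν h τ :=
          lintegral_mul_le_lintegral_rearr hD.measurable hh
      _ = ∫⁻ t, rearr ν D (σ t) * rearr ν h (σ t) ∂ν := by
          rw [← hσ]
          exact lintegral_map ((measurable_rearr ν D).mul (measurable_rearr ν h)) hσm
      _ ≤ _ := by
          refine lintegral_mono_ae (ae_mem_wMeas.mono fun t ht => mul_le_mul_left (rearr_le ?_) _)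
          rw [hσdef, ENNReal.ofReal_toReal (hfinν _ (inv_pos.2 ht.1))]
          refine measure_mono_ae (ae_mem_wMeas.mono fun x hx hxD => ?_)
          exact inv_strictAnti₀ hx.1 (not_le.1 fun h' => (hD h').not_gt hxD)

end IsWeight
end Weight

/-- The modular `∫_I φ(G/w)·w` of a `[0,∞]`-valued function. -/
def wModular (a : ℝ≥0∞) (φ w : ℝ → ℝ) (G : ℝ → ℝ≥0∞) : ℝ≥0∞ :=
  ∫⁻ t in Ioa' a, extFn φ (G t / ENNReal.ofReal (w t)) * ENNReal.ofReal (w t)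

theorem rearr_const_mul {X : Type*} [MeasurableSpace X] (μ : Measure X) (F : X → ℝ≥0∞)
    {c : ℝ≥0∞} (hc : c ≠ 0) (hc' : c ≠ ∞) (τ : ℝ) :
    rearr μ (fun x => c * F x) τ = c * rearr μ F τ := by
  refine eq_of_forall_lt_iff fun y => ?_
  have h : ∀ z, y < c * z ↔ y / c < z := fun z => by
    rw [ENNReal.div_lt_iff (Or.inl hc) (Or.inl hc'), mul_comm]
  simp_rw [lt_rearr_iff, h, lt_rearr_iff]

section Modular

variable {a : ℝ≥0∞} {φ w : ℝ → ℝ}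

theorem exists_mem_Ioa' (ha : 0 < a) : ∃ t, t ∈ Ioa' a := by
  obtain ⟨t, ht, hta⟩ := ENNReal.lt_iff_exists_real_btwn.1 ha
  exact ⟨t, by simpa using hta.1, hta.2⟩

theorem Ioo_subset_Ioa' {t : ℝ} (ht : t ∈ Ioa' a) : Ioo 0 t ⊆ Ioa' a := fun _ hs =>
  ⟨hs.1, (ENNReal.ofReal_le_ofReal hs.2.le).trans_lt ht.2⟩

theorem decRe_const_mul {f : ℝ → ℝ} (hf : Measurable f) {c : ℝ} (hc : 0 < c) (t : ℝ) :
    decRe a (fun x => c * f x) t = ENNReal.ofReal c * decRe a f t := by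
  rw [decRe_eq_rearr hf, decRe_eq_rearr (hf.const_mul c),
    ← rearr_const_mul _ _ (by simpa using hc) ofReal_ne_top]
  simp_rw [abs_mul, abs_of_pos hc, ENNReal.ofReal_mul hc.le]

theorem lintegral_ofReal_abs_mul_le {f g : ℝ → ℝ} (hf : Measurable f) (hg : Measurable g) :
    ∫⁻ t in Ioa' a, ENNReal.ofReal |f t * g t| ≤ ∫⁻ t in Ioa' a, decRe a f t * decRe a g t := by
  have hfm : Measurable fun t => ENNReal.ofReal |f t| :=
    ENNReal.measurable_ofReal.comp (measurable_abs.comp hf)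
  have hgm : Measurable fun t => ENNReal.ofReal |g t| :=
    ENNReal.measurable_ofReal.comp (measurable_abs.comp hg)
  have h := lintegral_mul_le_lintegral_rearr (μ := volume.restrict (Ioa' a)) hfm hgm
  rw [Measure.restrict_apply_univ, volume_Ioa'] at h
  simp_rw [abs_mul, ENNReal.ofReal_mul (abs_nonneg _), decRe_eq_rearr hf, decRe_eq_rearr hg]
  exact h

theorem exists_distr_lt_top {f : ℝ → ℝ} {t : ℝ} (h : decRe a f t < ∞) :
    ∃ s, 0 ≤ s ∧ distr a f s < ∞ := by
  obtain ⟨_, ⟨s, hs, rfl⟩, -⟩ := sInf_lt_iff.1 h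
  exact ⟨s, hs.1, hs.2.trans_lt ofReal_lt_top⟩

namespace IsWeight

variable (hw : IsWeight a w)
include hw

theorem ofReal_ne_zero {t : ℝ} (ht : t ∈ Ioa' a) : ENNReal.ofReal (w t) ≠ 0 := by
  simpa using hw.pos t ht

theorem Mmod_eq (f : ℝ → ℝ) : Mmod a φ w f = wModular a φ w (decRe a f) :=
  setLIntegral_congr_fun (measurableSet_Ioa' a) fun t ht => otermE_eq _ (hw.pos t ht)

theorem wModular_mul (H : ℝ → ℝ≥0∞) :
    wModular a φ w (fun t => H t * ENNReal.ofReal (w t)) =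
      ∫⁻ t in Ioa' a, extFn φ (H t) * ENNReal.ofReal (w t) :=
  setLIntegral_congr_fun (measurableSet_Ioa' a) fun t ht => by
    simp only
    rw [ENNReal.mul_div_cancel_right (hw.ofReal_ne_zero ht) ofReal_ne_top]

theorem ne_top_of_wModular_ne_top {G : ℝ → ℝ≥0∞} (hG : AntitoneOn G (Ioa' a))
    (h : wModular a φ w G ≠ ∞) : ∀ t ∈ Ioa' a, G t ≠ ∞ := fun t ht hGt => by
  refine h (top_le_iff.1 ?_)
  calc ∞ = ∫⁻ _ in Ioo 0 t, ∞ := by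
        rw [setLIntegral_const, Real.volume_Ioo, ENNReal.top_mul]
        simpa using ht.1
    _ ≤ ∫⁻ s in Ioo 0 t, extFn φ (G s / ENNReal.ofReal (w s)) * ENNReal.ofReal (w s) := by
        refine setLIntegral_mono' measurableSet_Ioo fun s hs => ?_
        have hsI := Ioo_subset_Ioa' ht hs
        have hGs : G s = ∞ := top_le_iff.1 (hGt.ge.trans (hG hsI ht hs.2.le))
        rw [hGs, ENNReal.top_div_of_ne_top ofReal_ne_top,
          extFn_top, ENNReal.top_mul (hw.ofReal_ne_zero hsI)]
    _ ≤ wModular a φ w G := lintegral_mono_set (Ioo_subset_Ioa' ht)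

end IsWeight

theorem IsNFn.wModular_mono (hφ : IsNFn φ) {G G' : ℝ → ℝ≥0∞} (h : ∀ t ∈ Ioa' a, G t ≤ G' t) :
    wModular a φ w G ≤ wModular a φ w G' :=
  setLIntegral_mono' (measurableSet_Ioa' a) fun t ht =>
    mul_le_mul_left (hφ.extFn_mono (ENNReal.div_le_div_right (h t ht) _)) _

theorem IsNFn.measurable_wModular (hφ : IsNFn φ) (hw : Measurable w) {G : ℝ → ℝ≥0∞}
    (hG : Measurable G) :
    Measurable fun t => extFn φ (G t / ENNReal.ofReal (w t)) * ENNReal.ofReal (w t) := by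
  have hwm := ENNReal.measurable_ofReal.comp hw
  exact (hφ.measurable_extFn.comp (hG.div hwm)).mul hwm

/-- A decreasing function of finite modular is realized by an element of `M_{φ,w}` whose pairing
with `g` is nearly maximal. -/
theorem IsWeight.exists_mem_Mclass (hw : IsWeight a w) (hφ : IsNFn φ) {g : ℝ → ℝ}
    (hg : Measurable g) (hfin : ∃ s, 0 ≤ s ∧ distr a g s < ∞) {K : ℝ} (hK : 1 < K)
    {G : ℝ → ℝ≥0∞} (hG : Measurable G) (hanti : AntitoneOn G (Ioa' a))
    (hmod : wModular a φ w G ≠ ∞) :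
    ∃ f ∈ Mclass a φ w, Mmod a φ w f ≤ wModular a φ w G ∧ (∀ x, 0 ≤ f x * g x) ∧
      ∫⁻ t in Ioa' a, decRe a g t * G t ≤
        ENNReal.ofReal K * ∫⁻ t in Ioa' a, ENNReal.ofReal (f t * g t) := by
  obtain ⟨f, hf, hfg, hle, hint⟩ := exists_decRe_le_lintegral_le hg hfin hK hG hanti
    (hw.ne_top_of_wModular_ne_top hanti hmod)
  have h : Mmod a φ w f ≤ wModular a φ w G := by
    rw [hw.Mmod_eq]
    exact hφ.wModular_mono hle
  refine ⟨f, ⟨hf, 1, one_pos, ?_⟩, h, hfg, hint⟩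
  simp only [one_mul]
  exact h.trans_lt (lt_top_iff_ne_top.2 hmod)

theorem Mnorm_le_one {f : ℝ → ℝ} (h : Mmod a φ w f ≤ 1) : Mnorm a φ w f ≤ 1 := by
  refine (iInf₂_le (1 : ℝ) ⟨one_pos, by simpa using h⟩).trans ?_
  simp

theorem IsWeight.decRe_ne_top (hw : IsWeight a w) {f : ℝ → ℝ} (hf : f ∈ Mclass a φ w) :
    ∀ t ∈ Ioa' a, decRe a f t ≠ ∞ := fun t ht hft => by
  obtain ⟨hfm, c, hc, hmod⟩ := hf
  rw [hw.Mmod_eq] at hmod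
  refine hw.ne_top_of_wModular_ne_top ((decRe_antitone a _).antitoneOn _) hmod.ne t ht ?_
  rw [decRe_const_mul hfm hc, hft, ENNReal.mul_top (by simpa using hc)]

theorem IsWeight.integrableOn_mul (hw : IsWeight a w) (hφ : IsNFn φ) {f g : ℝ → ℝ}
    (hf : f ∈ Mclass a φ w) (hg : g ∈ LamClass a (conjFn φ) w) :
    IntegrableOn (fun t => f t * g t) (Ioa' a) := by
  obtain ⟨hfm, c, hc, hmod⟩ := hf
  obtain ⟨hgm, hgfin, d, hd, hlam⟩ := hg
  refine ⟨(hfm.mul hgm).aestronglyMeasurable, ?_⟩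
  rw [hasFiniteIntegral_iff_norm]
  simp only [Real.norm_eq_abs]
  refine (lintegral_ofReal_abs_mul_le hfm hgm).trans_lt ?_
  rw [hw.Mmod_eq] at hmod
  have hfm' : Measurable fun t => decRe a f t * decRe a g t :=
    (measurable_decRe a f).mul (measurable_decRe a g)
  have key : ENNReal.ofReal (c * d) * ∫⁻ t in Ioa' a, decRe a f t * decRe a g t ≤
      wModular a φ w (decRe a fun t => c * f t) +
      ∫⁻ t in Ioa' a, ENNReal.ofReal (conjFn φ (d * (decRe a g t).toReal) * w t) := by
    rw [← lintegral_const_mul _ hfm', wModular, ← lintegral_add_left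
      (hφ.measurable_wModular hw.measurable (measurable_decRe a _))]
    refine setLIntegral_mono' (measurableSet_Ioa' a) fun t ht => ?_
    have h := hφ.mul_le_extFn_add_conjFn (decRe a (fun t => c * f t) t / ENNReal.ofReal (w t))
      (d * (decRe a g t).toReal)
    rw [ENNReal.ofReal_mul' (hw.pos t ht).le, ← add_mul]
    refine le_trans (le_of_eq ?_) (mul_le_mul_left h _)
    rw [decRe_const_mul hfm hc, ENNReal.ofReal_mul hc.le, ENNReal.ofReal_mul hd.le,
      ENNReal.ofReal_toReal (hgfin t ht).ne, mul_right_comm (_ / _),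
      ENNReal.div_mul_cancel (hw.ofReal_ne_zero ht) ofReal_ne_top]
    ring
  have hcd : ENNReal.ofReal (c * d) ≠ 0 := by simpa using mul_pos hc hd
  by_contra hcon
  rw [top_le_iff.1 (not_lt.1 hcon), ENNReal.mul_top hcd, top_le_iff] at key
  exact (ENNReal.add_lt_top.2 ⟨hmod, hlam⟩).ne key

theorem IsNFn.decRe_eq_zero_of_mem_LamClass (hφ : IsNFn φ) (hw : IsWeight a w) {f : ℝ → ℝ}
    (hf : f ∈ LamClass a (conjFn φ) w) {t : ℝ} (ht : t ∈ Ioa' a)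
    (hW : ∫⁻ s in Ioo 0 t, ENNReal.ofReal (w s) = ∞) : decRe a f t = 0 := by
  obtain ⟨hfm, hfin, c, hc, hlam⟩ := hf
  by_contra hne
  obtain ⟨κ, hκ, hle⟩ := hφ.exists_pos_le_conjFn
    (mul_pos hc (ENNReal.toReal_pos hne (hfin t ht).ne))
  refine hlam.not_ge (le_trans ?_ (lintegral_mono_set (Ioo_subset_Ioa' ht)))
  calc ∞ = ENNReal.ofReal κ * ∫⁻ s in Ioo 0 t, ENNReal.ofReal (w s) := by
        rw [hW, ENNReal.mul_top (by simpa using hκ)]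
    _ = ∫⁻ s in Ioo 0 t, ENNReal.ofReal κ * ENNReal.ofReal (w s) :=
        (lintegral_const_mul _ hw.measurable_ofReal).symm
    _ ≤ _ := by
        refine setLIntegral_mono' measurableSet_Ioo fun s hs => ?_
        have hsI := Ioo_subset_Ioa' ht hs
        rw [ENNReal.ofReal_mul' (hw.pos s hsI).le]
        refine mul_le_mul_left (ENNReal.ofReal_le_ofReal (hle _ ?_)) _
        exact mul_le_mul_of_nonneg_left (ENNReal.toReal_mono (hfin s hsI).ne
          (decRe_antitone a f hs.2.le)) hc.le

theorem IsWeight.ofReal_integral_le_lamOnorm (hw : IsWeight a w) {f g : ℝ → ℝ}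
    (hf : Measurable f) (hg : g ∈ Mclass a φ w) (hg1 : Mnorm a φ w g ≤ 1) :
    ENNReal.ofReal (∫ t in Ioa' a, f t * g t) ≤ lamOnorm a φ w f := by
  set h : ℝ → ℝ := (Ioa' a).indicator fun t => (decRe a g t).toReal / w t with hh
  have hhm : Measurable h :=
    ((ENNReal.measurable_toReal.comp (measurable_decRe a g)).div hw.measurable).indicator
      (measurableSet_Ioa' a)
  have hh0 : ∀ t, 0 ≤ h t := indicator_nonneg fun t ht =>
    div_nonneg ENNReal.toReal_nonneg (hw.pos t ht).le
  have hlux : luxNorm a φ w h ≤ 1 := by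
    refine le_trans (le_iInf₂ fun ε hε => biInf_le _ ⟨hε.1, le_trans ?_ hε.2⟩) hg1
    refine setLIntegral_mono' (measurableSet_Ioa' a) fun t ht => ?_
    have hwt := hw.pos t ht
    have h1 : decRe a (fun t => g t / ε) t = ENNReal.ofReal ε⁻¹ * decRe a g t := by
      rw [← decRe_const_mul hg.1 (inv_pos.2 hε.1)]
      simp_rw [div_eq_inv_mul]
    have h2 : decRe a (fun t => g t / ε) t ≠ ∞ := by
      rw [h1]
      exact ENNReal.mul_ne_top ofReal_ne_top (hw.decRe_ne_top hg t ht)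
    rw [otermE, if_neg h2, oterm, if_neg hwt.ne', h1, ENNReal.toReal_mul,
      ENNReal.toReal_ofReal (inv_pos.2 hε.1).le, abs_of_nonneg (hh0 t), hh, indicator_of_mem ht]
    refine le_of_eq ?_
    congr 3
    field_simp
  calc ENNReal.ofReal (∫ t in Ioa' a, f t * g t)
      ≤ ‖∫ t in Ioa' a, f t * g t‖ₑ := by
        rw [Real.enorm_eq_ofReal_abs]
        exact ENNReal.ofReal_le_ofReal (le_abs_self _)
    _ ≤ ∫⁻ t in Ioa' a, ‖f t * g t‖ₑ := enorm_integral_le_lintegral_enorm _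
    _ = ∫⁻ t in Ioa' a, ENNReal.ofReal |f t * g t| := by simp_rw [Real.enorm_eq_ofReal_abs]
    _ ≤ ∫⁻ t in Ioa' a, decRe a f t * decRe a g t := lintegral_ofReal_abs_mul_le hf hg.1
    _ = ∫⁻ t in Ioa' a, decRe a f t * ENNReal.ofReal (h t * w t) := by
        refine setLIntegral_congr_fun (measurableSet_Ioa' a) fun t ht => ?_
        rw [hh, indicator_of_mem ht, div_mul_cancel₀ _ (hw.pos t ht).ne',
          ENNReal.ofReal_toReal (hw.decRe_ne_top hg t ht)]
    _ ≤ lamOnorm a φ w f :=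
        le_iSup₂ (f := fun (g : ℝ → ℝ) (_ : g ∈ {g : ℝ → ℝ | Measurable g ∧ (∀ t, 0 ≤ g t) ∧
          luxNorm a φ w g ≤ 1}) => ∫⁻ t in Ioa' a, decRe a f t * ENNReal.ofReal (g t * w t))
          h ⟨hhm, hh0, hlux⟩

theorem IsWeight.lamOnorm_le (hw : IsWeight a w) (hφ : IsNFn φ) {f : ℝ → ℝ}
    (hf : f ∈ LamClass a (conjFn φ) w) :
    lamOnorm a φ w f ≤ ⨆ g ∈ {g : ℝ → ℝ | g ∈ Mclass a φ w ∧ Mnorm a φ w g ≤ 1},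
      ENNReal.ofReal (∫ t in Ioa' a, f t * g t) := by
  set S := ⨆ g ∈ {g : ℝ → ℝ | g ∈ Mclass a φ w ∧ Mnorm a φ w g ≤ 1},
      ENNReal.ofReal (∫ t in Ioa' a, f t * g t) with hS
  refine iSup₂_le fun h hh => ?_
  obtain ⟨hhm, hh0, hlux⟩ := hh
  by_cases hW : ∃ t ∈ Ioa' a, ∫⁻ s in Ioo 0 t, ENNReal.ofReal (w s) ≠ ∞
  swap
  · push Not at hW
    rw [setLIntegral_congr_fun (g := fun _ => 0) (measurableSet_Ioa' a) fun t ht => by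
      simp only; rw [hφ.decRe_eq_zero_of_mem_LamClass hw hf ht (hW t ht), zero_mul]]
    simp
  obtain ⟨t₀, ht₀, hW⟩ := hW
  have key : ∀ r : ℝ, 1 < r → ∫⁻ t in Ioa' a, decRe a f t * ENNReal.ofReal (h t * w t) ≤
      ENNReal.ofReal r * (ENNReal.ofReal r * S) := by
    intro r hr
    have hr' : (1 : ℝ≥0∞) < ENNReal.ofReal r := by simpa using hr
    obtain ⟨ε, ⟨hε, hmod⟩, hεr⟩ := by
      simpa only [luxNorm, iInf_lt_iff, exists_prop] using hlux.trans_lt hr'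
    have hhε : Measurable fun t => ENNReal.ofReal (h t / ε) :=
      ENNReal.measurable_ofReal.comp (hhm.div_const ε)
    obtain ⟨H, hHm, hHanti, hHmod, hHint⟩ :=
      hw.exists_antitoneOn hφ ht₀ hW (decRe_antitone a f) hhε
    have hHmod1 : wModular a φ w (fun t => H t * ENNReal.ofReal (w t)) ≤ 1 := by
      rw [hw.wModular_mul]
      refine hHmod.trans (le_trans (le_of_eq ?_) hmod)
      refine setLIntegral_congr_fun (measurableSet_Ioa' a) fun t ht => ?_
      rw [extFn_ofReal (div_nonneg (hh0 t) hε.le), abs_of_nonneg (hh0 t),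
        ENNReal.ofReal_mul' (hw.pos t ht).le]
    obtain ⟨g, hg, hgmod, hg0, hgint⟩ := hw.exists_mem_Mclass hφ hf.1
      (exists_distr_lt_top (hf.2.1 t₀ ht₀)) hr (hHm.mul hw.measurable_ofReal)
      (fun s hs t ht hst => mul_le_mul' (hHanti hs ht hst)
        (ENNReal.ofReal_le_ofReal (hw.anti s hs t ht hst)))
      (ne_top_of_le_ne_top one_ne_top hHmod1)
    have hint := hw.integrableOn_mul hφ hg hf
    have h1 : ∫⁻ t in Ioa' a, ENNReal.ofReal (g t * f t) ≤ S := by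
      rw [← ofReal_integral_eq_lintegral_ofReal hint (ae_of_all _ hg0)]
      simp_rw [mul_comm (g _)]
      exact le_iSup₂ (f := fun (g : ℝ → ℝ) (_ : g ∈ {g : ℝ → ℝ | g ∈ Mclass a φ w ∧
        Mnorm a φ w g ≤ 1}) => ENNReal.ofReal (∫ t in Ioa' a, f t * g t))
        g ⟨hg, Mnorm_le_one (hgmod.trans hHmod1)⟩
    calc ∫⁻ t in Ioa' a, decRe a f t * ENNReal.ofReal (h t * w t)
        = ∫⁻ t in Ioa' a, ENNReal.ofReal ε *
            (decRe a f t * (ENNReal.ofReal (h t / ε) * ENNReal.ofReal (w t))) := by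
          refine setLIntegral_congr_fun (measurableSet_Ioa' a) fun t ht => ?_
          rw [← ENNReal.ofReal_mul' (hw.pos t ht).le, mul_left_comm, ← ENNReal.ofReal_mul hε.le]
          congr 2
          field_simp
      _ = ENNReal.ofReal ε * ∫⁻ t in Ioa' a,
            decRe a f t * (ENNReal.ofReal (h t / ε) * ENNReal.ofReal (w t)) :=
          lintegral_const_mul _ ((measurable_decRe a f).mul (hhε.mul hw.measurable_ofReal))
      _ ≤ ENNReal.ofReal r * (ENNReal.ofReal r * S) :=
          mul_le_mul' hεr.le (hHint.trans (hgint.trans (mul_le_mul_right h1 _)))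
  rcases eq_or_ne S ∞ with hST | hST
  · rw [hST]
    exact le_top
  have hlim : Tendsto (fun r : ℝ => ENNReal.ofReal r * (ENNReal.ofReal r * S)) (𝓝[>] 1)
      (𝓝 S) := by
    have h1 : Tendsto (fun r : ℝ => ENNReal.ofReal (r * (r * S.toReal))) (𝓝[>] 1)
        (𝓝 (ENNReal.ofReal (1 * (1 * S.toReal)))) := by
      refine Tendsto.mono_left (Continuous.tendsto ?_ 1) nhdsWithin_le_nhds
      exact ENNReal.continuous_ofReal.comp (by fun_prop)
    rw [one_mul, one_mul, ENNReal.ofReal_toReal hST] at h1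
    refine h1.congr' ?_
    filter_upwards [self_mem_nhdsWithin] with r hr
    have hr0 : (0 : ℝ) ≤ r := zero_le_one.trans (le_of_lt hr)
    rw [ENNReal.ofReal_mul hr0, ENNReal.ofReal_mul hr0, ENNReal.ofReal_toReal hST]
  refine ge_of_tendsto hlim ?_
  filter_upwards [self_mem_nhdsWithin] with r hr using key r hr

end Modular

section Dual

variable {a : ℝ≥0∞} {φ w g : ℝ → ℝ}

theorem antitone_indicator_Iio {G : ℝ → ℝ≥0∞} (hG : Antitone G) (δ : ℝ) :
    Antitone ((Iio δ).indicator G) := fun s t hst => by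
  by_cases ht : t ∈ Iio δ
  · rw [indicator_of_mem ht, indicator_of_mem (show s ∈ Iio δ from lt_of_le_of_lt hst ht)]
    exact hG hst
  · rw [indicator_of_notMem ht]
    exact zero_le

theorem IsWeight.wModular_indicator_ne_top (hw : IsWeight a w) (hφ : IsNFn φ) {δ : ℝ}
    (hδ : δ ∈ Ioa' a) : wModular a φ w ((Iio δ).indicator fun _ => 1) ≠ ∞ := by
  set p := extFn φ (1 / ENNReal.ofReal (w δ)) * ENNReal.ofReal (w δ) with hp
  have hwδ := hw.ofReal_ne_zero hδ
  have hp' : p ≠ ∞ := by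
    rw [hp, extFn_of_ne_top (ENNReal.div_ne_top one_ne_top hwδ)]
    exact ENNReal.mul_ne_top ofReal_ne_top ofReal_ne_top
  have hle : wModular a φ w ((Iio δ).indicator fun _ => 1) ≤
      ∫⁻ t, (Ioo 0 δ).indicator (fun _ => p) t := by
    rw [wModular, ← lintegral_indicator (measurableSet_Ioa' a)]
    refine lintegral_mono fun t => ?_
    by_cases ht : t ∈ Ioa' a
    swap
    · rw [indicator_of_notMem ht]
      exact zero_le
    rw [indicator_of_mem ht]
    rcases lt_or_ge t δ with h | h
    · have hwt := hw.ofReal_ne_zero ht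
      rw [indicator_of_mem (show t ∈ Iio δ from h),
        indicator_of_mem (show t ∈ Ioo 0 δ from ⟨ht.1, h⟩)]
      have h1 : ENNReal.ofReal (w δ) / ENNReal.ofReal (w t) ≤ 1 :=
        ENNReal.div_le_of_le_mul (by
          rw [one_mul]
          exact ENNReal.ofReal_le_ofReal (hw.anti t ht δ hδ h.le))
      have h2 : 1 / ENNReal.ofReal (w t) =
          ENNReal.ofReal (w δ) / ENNReal.ofReal (w t) * (1 / ENNReal.ofReal (w δ)) := by
        rw [one_div, one_div, ENNReal.div_eq_inv_mul, mul_assoc,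
          ENNReal.mul_inv_cancel hwδ ofReal_ne_top, mul_one]
      rw [h2]
      refine (mul_le_mul_left (hφ.extFn_mul_le h1 _) _).trans (le_of_eq ?_)
      rw [mul_right_comm, ENNReal.div_mul_cancel hwt ofReal_ne_top, mul_comm]
    · rw [indicator_of_notMem (show t ∉ Iio δ from not_lt.2 h), ENNReal.zero_div,
        hφ.extFn_zero, zero_mul]
      exact zero_le
  refine ne_top_of_le_ne_top ?_ hle
  rw [lintegral_indicator_const measurableSet_Ioo, Real.volume_Ioo]
  exact ENNReal.mul_ne_top hp' ofReal_ne_top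

theorem IsWeight.exists_distr_lt_top_of_dual (ha : 0 < a) (hw : IsWeight a w) (hφ : IsNFn φ)
    (hg : Measurable g) (hdual : ∀ f ∈ Mclass a φ w, IntegrableOn (fun t => f t * g t) (Ioa' a)) :
    ∃ s, 0 ≤ s ∧ distr a g s < ∞ := by
  by_contra! hcon
  obtain ⟨δ, hδ⟩ := exists_mem_Ioa' ha
  have hB : ∀ k : ℕ, ∃ B ⊆ {t ∈ Ioa' a | 4 ^ k < |g t|}, MeasurableSet B ∧
      volume B = ENNReal.ofReal (δ * 2⁻¹ ^ (k + 1)) := fun k =>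
    exists_subset_volume_eq ((measurableSet_Ioa' a).inter
      (measurableSet_lt measurable_const (measurable_abs.comp hg))) (fun x hx => hx.1.1)
      (top_le_iff.1 (hcon (4 ^ k) (by positivity))) _
  choose B hBsub hBm hBvol using hB
  set E := ⋃ k, B k with hE
  have hEm : MeasurableSet E := MeasurableSet.iUnion hBm
  have hEvol : volume E ≤ ENNReal.ofReal δ := by
    refine (measure_iUnion_le _).trans (le_of_eq ?_)
    simp_rw [hBvol]
    rw [← ENNReal.ofReal_tsum_of_nonneg]
    · congr 1
      refine (tsum_congr fun k => ?_).trans (tsum_geometric_two' δ)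
      rw [inv_pow, pow_succ']
      field_simp
    · intro k
      exact mul_nonneg hδ.1.le (by positivity)
    · exact ((summable_geometric_of_lt_one (by norm_num) (by norm_num)).comp_injective
        (add_left_injective 1)).mul_left δ
  set f : ℝ → ℝ := E.indicator fun _ => 1 with hf
  have hfm : Measurable f := measurable_const.indicator hEm
  have hdec : ∀ t ∈ Ioa' a, decRe a f t ≤ (Iio δ).indicator (fun _ => 1) t := fun t ht => by
    rcases lt_or_ge t δ with h | h
    · rw [indicator_of_mem (show t ∈ Iio δ from h), ← ENNReal.ofReal_one]
      refine decRe_le_of_distr_le zero_le_one ?_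
      have : {t ∈ Ioa' a | 1 < |f t|} = ∅ := by
        refine eq_empty_of_forall_notMem fun x hx => ?_
        have h1 := hx.2
        by_cases hxE : x ∈ E <;> simp [hf, hxE] at h1
        linarith
      rw [distr, this, measure_empty]
      exact zero_le
    · rw [indicator_of_notMem (show t ∉ Iio δ from not_lt.2 h), ← ENNReal.ofReal_zero]
      refine decRe_le_of_distr_le le_rfl (le_trans (measure_mono fun x hx => ?_)
        (hEvol.trans (ENNReal.ofReal_le_ofReal h)))
      by_contra hxE
      have h1 := hx.2
      simp [hf, hxE] at h1
  have hfM : f ∈ Mclass a φ w := by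
    refine ⟨hfm, 1, one_pos, ?_⟩
    simp only [one_mul]
    rw [hw.Mmod_eq]
    exact (hφ.wModular_mono hdec).trans_lt
      (lt_top_iff_ne_top.2 (hw.wModular_indicator_ne_top hφ hδ))
  have hint := (hdual f hfM).2
  rw [hasFiniteIntegral_iff_norm] at hint
  have hlow : ∀ k : ℕ, ENNReal.ofReal (δ / 2 * 2 ^ k) ≤
      ∫⁻ t in Ioa' a, ENNReal.ofReal ‖f t * g t‖ := fun k => by
    calc ENNReal.ofReal (δ / 2 * 2 ^ k) = ∫⁻ _ in B k, ENNReal.ofReal (4 ^ k) := by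
          rw [setLIntegral_const, hBvol, ← ENNReal.ofReal_mul (by positivity)]
          congr 1
          rw [show (4 : ℝ) = 2 * 2 by norm_num, mul_pow, inv_pow, pow_succ']
          field_simp
      _ ≤ ∫⁻ t in B k, ENNReal.ofReal ‖f t * g t‖ := by
          refine setLIntegral_mono' (hBm k) fun t ht => ENNReal.ofReal_le_ofReal ?_
          have htE : t ∈ E := mem_iUnion.2 ⟨k, ht⟩
          rw [hf, indicator_of_mem htE, one_mul, Real.norm_eq_abs]
          exact (hBsub k ht).2.le
      _ ≤ _ := lintegral_mono_set fun t ht => (hBsub k ht).1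
  obtain ⟨k, hk⟩ := pow_unbounded_of_one_lt
    ((∫⁻ t in Ioa' a, ENNReal.ofReal ‖f t * g t‖).toReal / (δ / 2)) (one_lt_two (α := ℝ))
  have h1 := (ENNReal.ofReal_le_iff_le_toReal hint.ne).1 (hlow k)
  rw [div_lt_iff₀ (half_pos hδ.1)] at hk
  linarith

/-- If `g` pairs finitely with every decreasing function of finite modular, then the pairing is
bounded on the unit ball of the modular. -/
theorem IsWeight.exists_forall_lintegral_le (hw : IsWeight a w) (hφ : IsNFn φ)
    {D : ℝ → ℝ≥0∞} (hD : Measurable D)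
    (h : ∀ G, Measurable G → AntitoneOn G (Ioa' a) → wModular a φ w G ≠ ∞ →
      ∫⁻ t in Ioa' a, D t * G t ≠ ∞) :
    ∃ S ≠ ∞, ∀ G, Measurable G → AntitoneOn G (Ioa' a) → wModular a φ w G ≤ 1 →
      ∫⁻ t in Ioa' a, D t * G t ≤ S := by
  by_contra! hcon
  choose G hGm hGanti hGmod hGint using fun n : ℕ =>
    hcon (4 ^ n) (ENNReal.pow_ne_top (by norm_num))
  have hpow : ∀ n : ℕ, (2⁻¹ : ℝ≥0∞) ^ n ≤ 1 := fun n => pow_le_one' (by norm_num) n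
  refine h (fun t => ⨆ n, 2⁻¹ ^ n * G n t) (Measurable.iSup fun n => (hGm n).const_mul _)
    (fun s hs t ht hst => iSup_mono fun n => mul_le_mul_right (hGanti n hs ht hst) _) ?_ ?_
  · have hle : wModular a φ w (fun t => ⨆ n, 2⁻¹ ^ n * G n t) ≤ ∑' n : ℕ, (2⁻¹ : ℝ≥0∞) ^ n := by
      calc wModular a φ w (fun t => ⨆ n, 2⁻¹ ^ n * G n t)
          ≤ ∫⁻ t in Ioa' a, ∑' n, 2⁻¹ ^ n *
              (extFn φ (G n t / ENNReal.ofReal (w t)) * ENNReal.ofReal (w t)) := by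
            refine lintegral_mono fun t => ?_
            simp only [← mul_assoc]
            rw [ENNReal.tsum_mul_right]
            refine mul_le_mul_left ?_ _
            rw [ENNReal.iSup_div]
            refine (hφ.extFn_iSup_le _).trans (iSup_le fun n => ?_)
            rw [mul_div_assoc]
            exact (hφ.extFn_mul_le (hpow n) _).trans (ENNReal.le_tsum n)
        _ = ∑' n, 2⁻¹ ^ n * wModular a φ w (G n) := by
            have hm := fun n => hφ.measurable_wModular hw.measurable (hGm n)
            rw [lintegral_tsum fun n => ((hm n).const_mul _).aemeasurable]
            exact tsum_congr fun n => lintegral_const_mul _ (hm n)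
        _ ≤ _ := ENNReal.tsum_le_tsum fun n => mul_le_of_le_one_right' (hGmod n)
    refine ne_top_of_le_ne_top ?_ hle
    rw [ENNReal.tsum_geometric, ENNReal.one_sub_inv_two, inv_inv]
    norm_num
  · refine ENNReal.eq_top_of_forall_nnreal_le fun r => ?_
    obtain ⟨n, hn⟩ := pow_unbounded_of_one_lt r (one_lt_two (α := NNReal))
    calc (r : ℝ≥0∞) ≤ 2 ^ n := by exact_mod_cast hn.le
      _ = 2⁻¹ ^ n * 4 ^ n := by
          rw [← mul_pow]
          congr 1
          rw [show (4 : ℝ≥0∞) = 2 * 2 by norm_num, ← mul_assoc,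
            ENNReal.inv_mul_cancel (by norm_num) (by norm_num), one_mul]
      _ ≤ 2⁻¹ ^ n * ∫⁻ t in Ioa' a, D t * G n t := mul_le_mul_right (hGint n).le _
      _ = ∫⁻ t in Ioa' a, 2⁻¹ ^ n * (D t * G n t) :=
          (lintegral_const_mul _ (hD.mul (hGm n))).symm
      _ ≤ _ := lintegral_mono fun t => by
          rw [mul_left_comm]
          exact mul_le_mul_right (le_iSup (fun n => 2⁻¹ ^ n * G n t) n) _

theorem IsWeight.eq_zero_of_lintegral_le (hw : IsWeight a w) (hφ : IsNFn φ) {D : ℝ → ℝ≥0∞}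
    (hD : Antitone D) {S : ℝ≥0∞} (hS : S ≠ ∞)
    (h : ∀ G, Measurable G → AntitoneOn G (Ioa' a) → wModular a φ w G ≤ 1 →
      ∫⁻ t in Ioa' a, D t * G t ≤ S)
    {t₀ : ℝ} (ht₀ : t₀ ∈ Ioa' a) (hW : ∫⁻ s in Ioo 0 t₀, ENNReal.ofReal (w s) = ∞) :
    D t₀ = 0 := by
  have key : ∀ l : ℝ, 0 < l → D t₀ ≤ S * ENNReal.ofReal (φ l / l) := by
    intro l hl
    have hp0 : ENNReal.ofReal (φ l) ≠ 0 := by simpa using hφ.pos hl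
    set p := ENNReal.ofReal (φ l) with hp
    have hpt : p ≠ ∞ := ofReal_ne_top
    have hmm : ∀ N : ℕ, Measurable fun s => min (ENNReal.ofReal (w s)) N := fun N =>
      hw.measurable_ofReal.min measurable_const
    obtain ⟨N, hN⟩ : ∃ N : ℕ, p⁻¹ < ∫⁻ s in Ioo 0 t₀, min (ENNReal.ofReal (w s)) N := by
      rw [← lt_iSup_iff, ← lintegral_iSup hmm (fun m n hmn s => by
        exact min_le_min_left _ (by exact_mod_cast hmn))]
      have : ∀ s, ⨆ N : ℕ, min (ENNReal.ofReal (w s)) N = ENNReal.ofReal (w s) := fun s => by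
        rw [← inf_iSup_eq, ENNReal.iSup_natCast, inf_top_eq]
      simp_rw [this, hW]
      exact lt_top_iff_ne_top.2 (ENNReal.inv_ne_top.2 hp0)
    set m : ℝ → ℝ≥0∞ := fun s => min (ENNReal.ofReal (w s)) N with hm
    set V := ∫⁻ s in Ioo 0 t₀, m s with hV
    have hVt : V ≠ ∞ := by
      refine ne_top_of_le_ne_top (b := ∫⁻ _ in Ioo 0 t₀, (N : ℝ≥0∞)) ?_
        (lintegral_mono fun s => min_le_right _ _)
      rw [setLIntegral_const, Real.volume_Ioo]
      exact ENNReal.mul_ne_top (by simp) ofReal_ne_top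
    have hpV : 1 ≤ p * V := by
      rw [← ENNReal.mul_inv_cancel hp0 hpt]
      exact mul_le_mul_right hN.le p
    have hpV0 : p * V ≠ 0 := (one_pos.trans_le hpV).ne'
    have hpVt : p * V ≠ ∞ := ENNReal.mul_ne_top hpt hVt
    set θ := (p * V)⁻¹ with hθ
    have hθ1 : θ ≤ 1 := ENNReal.inv_le_one.2 hpV
    set G : ℝ → ℝ≥0∞ := (Iio t₀).indicator fun s => θ * m s * ENNReal.ofReal l with hG
    have hGm : Measurable G :=
      (((hmm N).const_mul θ).mul_const _).indicator measurableSet_Iio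
    have hGanti : AntitoneOn G (Ioa' a) := fun s hs t ht hst => by
      rw [hG]
      by_cases h' : t ∈ Iio t₀
      · rw [indicator_of_mem h',
          indicator_of_mem (show s ∈ Iio t₀ from lt_of_le_of_lt hst h')]
        have : m t ≤ m s :=
          min_le_min_right _ (ENNReal.ofReal_le_ofReal (hw.anti s hs t ht hst))
        gcongr
      · rw [indicator_of_notMem h']
        exact zero_le
    have hGmod : wModular a φ w G ≤ 1 := by
      have hle : wModular a φ w G ≤ ∫⁻ t, (Ioo 0 t₀).indicator (fun s => θ * p * m s) t := by
        rw [wModular, ← lintegral_indicator (measurableSet_Ioa' a)]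
        refine lintegral_mono fun t => ?_
        by_cases ht : t ∈ Ioa' a
        swap
        · rw [indicator_of_notMem ht]
          exact zero_le
        rw [indicator_of_mem ht]
        have hwt := hw.ofReal_ne_zero ht
        rcases lt_or_ge t t₀ with h' | h'
        · rw [indicator_of_mem (show t ∈ Ioo 0 t₀ from ⟨ht.1, h'⟩), hG,
            indicator_of_mem (show t ∈ Iio t₀ from h')]
          have h1 : m t / ENNReal.ofReal (w t) ≤ 1 :=
            ENNReal.div_le_of_le_mul (by rw [one_mul]; exact min_le_left _ _)
          have h2 : θ * m t * ENNReal.ofReal l / ENNReal.ofReal (w t) =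
              θ * (m t / ENNReal.ofReal (w t)) * ENNReal.ofReal l := by
            simp only [ENNReal.div_eq_inv_mul]
            ring
          rw [h2]
          refine (mul_le_mul_left (hφ.extFn_mul_le (mul_le_one' hθ1 h1) _) _).trans
            (le_of_eq ?_)
          rw [extFn_ofReal hl.le, ← hp, mul_right_comm, mul_assoc θ,
            ENNReal.div_mul_cancel hwt ofReal_ne_top, mul_right_comm]
        · rw [hG, indicator_of_notMem (show t ∉ Iio t₀ from not_lt.2 h'), ENNReal.zero_div,
            hφ.extFn_zero, zero_mul]
          exact zero_le
      refine hle.trans (le_of_eq ?_)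
      rw [lintegral_indicator measurableSet_Ioo, lintegral_const_mul _ (hmm N), mul_assoc]
      exact ENNReal.inv_mul_cancel hpV0 hpVt
    have hlow : D t₀ * (ENNReal.ofReal l * p⁻¹) ≤ S := by
      refine le_trans ?_ (h G hGm hGanti hGmod)
      calc D t₀ * (ENNReal.ofReal l * p⁻¹) = D t₀ * (θ * ENNReal.ofReal l) * V := by
            have hV0 : V ≠ 0 := right_ne_zero_of_mul hpV0
            rw [hθ, ENNReal.mul_inv (Or.inl hp0) (Or.inl hpt)]
            calc D t₀ * (ENNReal.ofReal l * p⁻¹)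
                = D t₀ * (ENNReal.ofReal l * p⁻¹) * (V⁻¹ * V) := by
                  rw [ENNReal.inv_mul_cancel hV0 hVt, mul_one]
              _ = _ := by ring
        _ = ∫⁻ s in Ioo 0 t₀, D t₀ * (θ * ENNReal.ofReal l) * m s :=
            (lintegral_const_mul _ (hmm N)).symm
        _ ≤ ∫⁻ s in Ioo 0 t₀, D s * G s := by
            refine setLIntegral_mono' measurableSet_Ioo fun s hs => ?_
            rw [hG, indicator_of_mem (show s ∈ Iio t₀ from hs.2), mul_assoc, mul_right_comm θ]
            exact mul_le_mul_left (hD hs.2.le) _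
        _ ≤ _ := lintegral_mono_set (Ioo_subset_Ioa' ht₀)
    have hl0 : ENNReal.ofReal l ≠ 0 := by simpa using hl
    calc D t₀ = D t₀ * (ENNReal.ofReal l * p⁻¹) * (p * (ENNReal.ofReal l)⁻¹) := by
          have : ENNReal.ofReal l * p⁻¹ * (p * (ENNReal.ofReal l)⁻¹) = 1 := by
            calc _ = (ENNReal.ofReal l * (ENNReal.ofReal l)⁻¹) * (p * p⁻¹) := by ring
              _ = 1 := by
                rw [ENNReal.mul_inv_cancel hp0 hpt, ENNReal.mul_inv_cancel hl0 ofReal_ne_top,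
                  one_mul]
          rw [mul_assoc, this, mul_one]
      _ ≤ S * (p * (ENNReal.ofReal l)⁻¹) := mul_le_mul_left hlow _
      _ = _ := by rw [ENNReal.ofReal_div_of_pos hl, ENNReal.div_eq_inv_mul, mul_comm p]
  have hlim : Tendsto (fun l => S * ENNReal.ofReal (φ l / l)) (𝓝[>] 0) (𝓝 0) := by
    have := ENNReal.Tendsto.const_mul (a := S) (ENNReal.tendsto_ofReal hφ.2.1) (Or.inr hS)
    simpa using this
  refine le_antisymm (ge_of_tendsto hlim ?_) zero_le
  filter_upwards [self_mem_nhdsWithin] with l hl using key l hl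

theorem IsWeight.lintegral_conjFn_le_one (hw : IsWeight a w) (hφ : IsNFn φ) {D : ℝ → ℝ≥0∞}
    (hD : Antitone D) (hDt : ∀ t ∈ Ioa' a, D t ≠ ∞) {S : ℝ≥0∞}
    (h : ∀ G, Measurable G → AntitoneOn G (Ioa' a) → wModular a φ w G ≤ 1 →
      ∫⁻ t in Ioa' a, D t * G t ≤ S)
    {t₀ : ℝ} (ht₀ : t₀ ∈ Ioa' a) (hW : ∫⁻ s in Ioo 0 t₀, ENNReal.ofReal (w s) ≠ ∞)
    {c : ℝ} (hc : 0 < c) (hcS : S < (ENNReal.ofReal c)⁻¹) :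
    ∫⁻ t in Ioa' a, ENNReal.ofReal (conjFn φ (c * (D t).toReal) * w t) ≤ 1 := by
  set C := ENNReal.ofReal c with hC
  have hC0 : C ≠ 0 := by simpa [hC] using hc
  have hCt : C ≠ ∞ := ofReal_ne_top
  set d : ℕ → ℝ → ℝ≥0∞ := fun n => (Iio (n : ℝ)).indicator fun t => min (D t) n with hd
  have hdanti : ∀ n, Antitone (d n) := fun n =>
    antitone_indicator_Iio (fun s t hst => min_le_min_right _ (hD hst)) n
  have hdle : ∀ n t, d n t ≤ D t := fun n t => by
    by_cases ht : t ∈ Iio (n : ℝ)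
    · simp only [hd, indicator_of_mem ht]
      exact min_le_left _ _
    · simp only [hd, indicator_of_notMem ht]
      exact zero_le
  have hdn : ∀ n t, d n t ≤ n := fun n t => by
    by_cases ht : t ∈ Iio (n : ℝ)
    · simp only [hd, indicator_of_mem ht]
      exact min_le_right _ _
    · simp only [hd, indicator_of_notMem ht]
      exact zero_le
  have hdmono : ∀ t, Monotone fun n => d n t := fun t m n hmn => by
    have hmn' : (m : ℝ) ≤ n := by exact_mod_cast hmn
    by_cases ht : t ∈ Iio (m : ℝ)
    · simp only [hd, indicator_of_mem ht,
        indicator_of_mem (show t ∈ Iio (n : ℝ) from lt_of_lt_of_le ht hmn')]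
      exact min_le_min_left _ (by exact_mod_cast hmn)
    · simp only [hd, indicator_of_notMem ht]
      exact zero_le
  set q : ℕ → ℝ → ℝ≥0∞ := fun n t => maxSlope φ (C * d n t) with hq
  have hqanti : ∀ n, Antitone (q n) := fun n s t hst =>
    maxSlope_mono φ (mul_le_mul_right (hdanti n hst) C)
  have hqdm : ∀ n, Measurable fun t => q n t * (C * d n t) * ENNReal.ofReal (w t) := fun n =>
    ((hqanti n).measurable.mul ((hdanti n).measurable.const_mul C)).mul hw.measurable_ofReal
  have hbound : ∀ n, ∫⁻ t in Ioa' a, q n t * (C * d n t) * ENNReal.ofReal (w t) ≤ 1 := by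
    intro n
    set T := ∫⁻ t in Ioa' a, q n t * (C * d n t) * ENNReal.ofReal (w t) with hT
    have hTt : T ≠ ∞ := by
      have hle : T ≤ ∫⁻ t in Ioa' a ∩ Iio (n : ℝ),
          maxSlope φ (C * n) * (C * n) * ENNReal.ofReal (w t) := by
        rw [hT, ← lintegral_indicator (measurableSet_Ioa' a),
          ← lintegral_indicator ((measurableSet_Ioa' a).inter measurableSet_Iio)]
        refine lintegral_mono fun t => ?_
        by_cases ht : t ∈ Ioa' a
        swap
        · rw [indicator_of_notMem ht]
          exact zero_le
        rw [indicator_of_mem ht]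
        by_cases htn : t ∈ Iio (n : ℝ)
        · rw [indicator_of_mem (mem_inter ht htn)]
          have h1 : C * d n t ≤ C * n := mul_le_mul_right (hdn n t) C
          exact mul_le_mul_left (mul_le_mul' (maxSlope_mono φ h1) h1) _
        · have : d n t = 0 := by simp only [hd, indicator_of_notMem htn]
          rw [this, mul_zero, mul_zero, zero_mul]
          exact zero_le
      refine ne_top_of_le_ne_top ?_ hle
      rw [lintegral_const_mul _ hw.measurable_ofReal]
      have hCn : C * n ≠ ∞ := ENNReal.mul_ne_top hCt (by simp)
      refine ENNReal.mul_ne_top (ENNReal.mul_ne_top (hφ.maxSlope_ne_top hCn) hCn)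
        (ne_top_of_le_ne_top ?_ (hw.lintegral_Ioo_le ht₀))
      exact ENNReal.add_ne_top.2 ⟨hW, ENNReal.mul_ne_top ofReal_ne_top ofReal_ne_top⟩
    by_contra! hT1
    have hT0 : T ≠ 0 := (one_pos.trans hT1).ne'
    have hG := h (fun t => T⁻¹ * q n t * ENNReal.ofReal (w t))
      (((hqanti n).measurable.const_mul _).mul hw.measurable_ofReal)
      (fun s hs t ht hst => mul_le_mul' (mul_le_mul_right (hqanti n hst) _)
        (ENNReal.ofReal_le_ofReal (hw.anti s hs t ht hst))) (by
          rw [hw.wModular_mul]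
          calc ∫⁻ t in Ioa' a, extFn φ (T⁻¹ * q n t) * ENNReal.ofReal (w t)
              ≤ ∫⁻ t in Ioa' a, T⁻¹ * (q n t * (C * d n t) * ENNReal.ofReal (w t)) := by
                refine lintegral_mono fun t => ?_
                rw [← mul_assoc]
                refine mul_le_mul_left ((hφ.extFn_mul_le (ENNReal.inv_le_one.2 hT1.le) _).trans
                  (mul_le_mul_right (hφ.extFn_maxSlope_le _) _)) _
            _ = 1 := by
                rw [lintegral_const_mul _ (hqdm n), ← hT, ENNReal.inv_mul_cancel hT0 hTt])
    refine hcS.not_ge (le_trans ?_ hG)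
    calc C⁻¹ = C⁻¹ * T⁻¹ * T := by rw [mul_assoc, ENNReal.inv_mul_cancel hT0 hTt, mul_one]
      _ = ∫⁻ t in Ioa' a, C⁻¹ * T⁻¹ * (q n t * (C * d n t) * ENNReal.ofReal (w t)) :=
          (lintegral_const_mul _ (hqdm n)).symm
      _ ≤ _ := by
          refine lintegral_mono fun t => ?_
          calc C⁻¹ * T⁻¹ * (q n t * (C * d n t) * ENNReal.ofReal (w t))
              = C⁻¹ * C * (d n t * (T⁻¹ * q n t * ENNReal.ofReal (w t))) := by ring
            _ = d n t * (T⁻¹ * q n t * ENNReal.ofReal (w t)) := by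
                rw [ENNReal.inv_mul_cancel hC0 hCt, one_mul]
            _ ≤ _ := mul_le_mul_left (hdle n t) _
  calc ∫⁻ t in Ioa' a, ENNReal.ofReal (conjFn φ (c * (D t).toReal) * w t)
      ≤ ∫⁻ t in Ioa' a, ⨆ n, q n t * (C * d n t) * ENNReal.ofReal (w t) := by
        refine setLIntegral_mono' (measurableSet_Ioa' a) fun t ht => ?_
        obtain ⟨n, hn⟩ := exists_nat_gt (max t (D t).toReal)
        refine le_trans ?_ (le_iSup _ n)
        have hdn' : d n t = D t := by
          have h1 : t < n := (le_max_left _ _).trans_lt hn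
          have h2 : D t ≤ n := by
            rw [← ENNReal.toReal_le_toReal (hDt t ht) (by simp)]
            simpa using ((le_max_right _ _).trans hn.le)
          simp only [hd, indicator_of_mem (show t ∈ Iio (n : ℝ) from h1), min_eq_left h2]
        have h3 := hφ.conjFn_le_maxSlope (x := C * D t) (ENNReal.mul_ne_top hCt (hDt t ht))
        rw [ENNReal.toReal_mul, hC, ENNReal.toReal_ofReal hc.le, ← hC] at h3
        rw [ENNReal.ofReal_mul' (hw.pos t ht).le]
        simp only [hq, hdn']
        exact mul_le_mul_left h3 _
    _ = ⨆ n, ∫⁻ t in Ioa' a, q n t * (C * d n t) * ENNReal.ofReal (w t) := by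
        refine lintegral_iSup hqdm fun m n hmn t => ?_
        have h1 : C * d m t ≤ C * d n t := mul_le_mul_right (hdmono t hmn) C
        exact mul_le_mul_left (mul_le_mul' (maxSlope_mono φ h1) h1) _
    _ ≤ 1 := iSup_le hbound

theorem IsWeight.mem_LamClass_of_dual (ha : 0 < a) (hw : IsWeight a w) (hφ : IsNFn φ)
    (hg : Measurable g) (hdual : ∀ f ∈ Mclass a φ w, IntegrableOn (fun t => f t * g t) (Ioa' a)) :
    g ∈ LamClass a (conjFn φ) w := by
  have hfin := hw.exists_distr_lt_top_of_dual ha hφ hg hdual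
  have hpair : ∀ G, Measurable G → AntitoneOn G (Ioa' a) → wModular a φ w G ≠ ∞ →
      ∫⁻ t in Ioa' a, decRe a g t * G t ≠ ∞ := fun G hG hanti hmod => by
    obtain ⟨f, hf, -, hf0, hle⟩ := hw.exists_mem_Mclass hφ hg hfin one_lt_two hG hanti hmod
    refine ne_top_of_le_ne_top (ENNReal.mul_ne_top ofReal_ne_top ?_) hle
    rw [← ofReal_integral_eq_lintegral_ofReal (hdual f hf) (ae_of_all _ hf0)]
    exact ofReal_ne_top
  have hne : ∀ t ∈ Ioa' a, decRe a g t ≠ ∞ := fun t ht htop => by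
    refine hpair _ (measurable_const.indicator measurableSet_Iio)
      ((antitone_indicator_Iio antitone_const t).antitoneOn _)
      (hw.wModular_indicator_ne_top hφ ht) (top_le_iff.1 ?_)
    calc ∞ = ∫⁻ _ in Ioo 0 t, ∞ := by
          rw [setLIntegral_const, Real.volume_Ioo, ENNReal.top_mul]
          simpa using ht.1
      _ ≤ ∫⁻ s in Ioo 0 t, decRe a g s * (Iio t).indicator (fun _ => 1) s := by
          refine setLIntegral_mono' measurableSet_Ioo fun s hs => ?_
          rw [indicator_of_mem (show s ∈ Iio t from hs.2), mul_one, ← htop]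
          exact decRe_antitone a g hs.2.le
      _ ≤ _ := lintegral_mono_set (Ioo_subset_Ioa' ht)
  obtain ⟨S, hS, hSle⟩ := hw.exists_forall_lintegral_le hφ (measurable_decRe a g) hpair
  refine ⟨hg, fun t ht => lt_top_iff_ne_top.2 (hne t ht), ?_⟩
  by_cases hW : ∃ t ∈ Ioa' a, ∫⁻ s in Ioo 0 t, ENNReal.ofReal (w s) ≠ ∞
  · obtain ⟨t₀, ht₀, hW⟩ := hW
    have hc : 0 < (S.toReal + 1)⁻¹ := inv_pos.2 (by positivity)
    refine ⟨(S.toReal + 1)⁻¹, hc, (hw.lintegral_conjFn_le_one hφ (decRe_antitone a g) hne hSle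
      ht₀ hW hc ?_).trans_lt one_lt_top⟩
    rw [ENNReal.ofReal_inv_of_pos (by positivity), inv_inv,
      ENNReal.lt_ofReal_iff_toReal_lt hS]
    linarith
  · push Not at hW
    refine ⟨1, one_pos, ?_⟩
    have h0 : conjFn φ 0 ≤ 0 := by
      refine csSup_le ⟨_, 1, mem_Ioi.2 one_pos, rfl⟩ ?_
      rintro _ ⟨s, hs, rfl⟩
      have := hφ.pos hs
      simp only; linarith
    rw [setLIntegral_congr_fun (g := fun _ => 0) (measurableSet_Ioa' a) fun t ht => by
      simp only
      rw [hw.eq_zero_of_lintegral_le hφ (decRe_antitone a g) hS hSle ht (hW t ht),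
        ENNReal.toReal_zero, mul_zero]
      exact ENNReal.ofReal_of_nonpos (mul_nonpos_of_nonpos_of_nonneg h0 (hw.pos t ht).le)]
    simp

end Dual

/-- for an `N`-function `φ` with complementary function `φ*` and a positive
decreasing weight `w`, the Köthe dual of the class `M_{φ,w}` is, as a set, the
Orlicz–Lorentz space `Λ_{φ*,w}`, and for every `f ∈ Λ_{φ*,w}` the Orlicz norm satisfies
`‖f‖⁰_{Λ_{φ*,w}} = sup{∫_I f·g : g ∈ M_{φ,w}, ‖g‖_M ≤ 1}`. -/
theorem statement14 (a : ℝ≥0∞) (ha : 0 < a) (φ : ℝ → ℝ) (hφ : IsNFn φ)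
    (w : ℝ → ℝ) (hw_meas : Measurable w) (hw_pos : ∀ t ∈ Ioa' a, 0 < w t)
    (hw_dec : ∀ s ∈ Ioa' a, ∀ t ∈ Ioa' a, s ≤ t → w t ≤ w s) :
    ({g : ℝ → ℝ | Measurable g ∧ ∀ f ∈ Mclass a φ w,
        IntegrableOn (fun t => f t * g t) (Ioa' a)} =
      LamClass a (conjFn φ) w) ∧
    ∀ f ∈ LamClass a (conjFn φ) w,
      lamOnorm a φ w f =
        ⨆ g ∈ {g : ℝ → ℝ | g ∈ Mclass a φ w ∧ Mnorm a φ w g ≤ 1},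
          ENNReal.ofReal (∫ t in Ioa' a, f t * g t) := by
  have hw : IsWeight a w := ⟨hw_meas, hw_pos, hw_dec⟩
  refine ⟨Set.ext fun g => ⟨fun hg => hw.mem_LamClass_of_dual ha hφ hg.1 hg.2,
    fun hg => ⟨hg.1, fun f hf => hw.integrableOn_mul hφ hf hg⟩⟩, fun f hf =>
    le_antisymm (hw.lamOnorm_le hφ hf) (iSup₂_le fun g hg =>
      hw.ofReal_integral_le_lamOnorm hf.1 hg.1 hg.2)⟩

end OrliczRearrangement

end
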